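/- arXiv:2404.17414 — 3 statements merged into one kernel-verified Lean document; each statement's English description precedes it below -/
import Mathlib

section
/- For every ξ > 0 there exists a unique pair (t,q) with 0 ≤ t ≤ 1, satisfying (t > 0 or q < −1), such that log( ∑_{n=1}^{∞} 2^{−n t} n^{q} ) = qξ and ( ∑_{n=1}^{∞} 2^{−n t} (log n) n^{q} ) / ( ∑_{n=1}^{∞} 2^{−n t} n^{q} ) = ξ; and for this pair, the Hausdorff dimension of the set {x ∈ (0,1] : lim_{m→∞} (1/m) ∑_{j=1}^{m} log(d_j(x)) = ξ} equals t. -/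
open MeasureTheory Filter Real Set

/-- The power-2-decaying Gauss-like expansion map: `T x = 2^n x - 1` for
`x ∈ (2^{-n}, 2^{-(n-1)}]`, where the branch index is `n = ⌊-log₂ x⌋ + 1`. -/
noncomputable def p2gleT (x : ℝ) : ℝ := 2 ^ (⌊-Real.logb 2 x⌋ + 1) * x - 1

/-- The `(j+1)`-th P2GLE digit: `d_{j+1}(x) = d₁(T^j x)` with `d₁(x) = ⌈-log₂ x⌉`. -/
noncomputable def p2gleD (j : ℕ) (x : ℝ) : ℤ := ⌈-Real.logb 2 (p2gleT^[j] x)⌉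

/-- The level set `E(ξ)` of points whose Khintchine exponent equals `ξ`. -/
noncomputable def khinchinLevelSet (ξ : ℝ) : Set ℝ :=
  {x ∈ Ioc (0:ℝ) 1 |
    Tendsto (fun n : ℕ => (∑ j ∈ Finset.range n, (p2gleD j x : ℝ)) / n) atTop (nhds ξ)}

/-- The level set of points whose Birkhoff average of `log d₁` equals `ξ`. -/
noncomputable def logDigitLevelSet (ξ : ℝ) : Set ℝ :=
  {x ∈ Ioc (0:ℝ) 1 |
    Tendsto (fun m : ℕ => (∑ j ∈ Finset.range m, Real.log (p2gleD j x : ℝ)) / m)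
      atTop (nhds ξ)}

/-- The weight `2^{-nt} e^{q(log n - ξ)}` of the digit `n`. -/
noncomputable def digitWeight (ξ t q : ℝ) (n : ℕ+) : ℝ :=
  (2:ℝ) ^ (-((n : ℕ) : ℝ) * t) * exp (q * (Real.log ((n : ℕ) : ℝ) - ξ))

lemma one_le_pnat_cast (n : ℕ+) : (1:ℝ) ≤ ((n : ℕ) : ℝ) := by exact_mod_cast n.pos

lemma digitWeight_pos (ξ t q : ℝ) (n : ℕ+) : 0 < digitWeight ξ t q n := by
  unfold digitWeight; positivity

lemma digitWeight_eq (ξ t q : ℝ) (n : ℕ+) :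
    digitWeight ξ t q n =
      exp (-(q * ξ)) * ((2:ℝ) ^ (-((n : ℕ) : ℝ) * t) * ((n : ℕ) : ℝ) ^ q) := by
  have hn : (0:ℝ) < ((n : ℕ) : ℝ) := by exact_mod_cast n.pos
  rw [digitWeight, Real.rpow_def_of_pos hn, mul_left_comm, ← Real.exp_add]
  ring_nf

lemma summable_two_rpow_mul_rpow {t : ℝ} (ht : 0 < t) (q : ℝ) :
    Summable fun n : ℕ+ => (2:ℝ) ^ (-((n : ℕ) : ℝ) * t) * ((n : ℕ) : ℝ) ^ q := by
  obtain ⟨k, hk⟩ := exists_nat_ge q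
  have hr : ‖(2:ℝ) ^ (-t)‖ < 1 := by
    rw [Real.norm_of_nonneg (by positivity)]
    exact Real.rpow_lt_one_of_one_lt_of_neg (by norm_num) (by linarith)
  have h := (summable_pow_mul_geometric_of_norm_lt_one k hr).comp_injective PNat.coe_injective
  refine Summable.of_nonneg_of_le (fun n => by positivity) (fun n => ?_) h
  have h2 : (2:ℝ) ^ (-((n : ℕ) : ℝ) * t) = ((2:ℝ) ^ (-t)) ^ (n : ℕ) := by
    rw [← Real.rpow_natCast, ← Real.rpow_mul (by norm_num)]
    ring_nf
  simp only [Function.comp_apply]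
  rw [h2, mul_comm]
  gcongr
  rw [← Real.rpow_natCast]
  exact Real.rpow_le_rpow_of_exponent_le (one_le_pnat_cast n) hk

lemma summable_digitWeight (ξ : ℝ) {t : ℝ} (ht : 0 < t) (q : ℝ) :
    Summable (digitWeight ξ t q) := by
  simp only [funext (digitWeight_eq ξ t q)]
  exact (summable_two_rpow_mul_rpow ht q).mul_left _

lemma summable_log_mul {t : ℝ} (ht : 0 < t) (q : ℝ) :
    Summable fun n : ℕ+ =>
      (2:ℝ) ^ (-((n : ℕ) : ℝ) * t) * Real.log ((n : ℕ) : ℝ) * ((n : ℕ) : ℝ) ^ q := by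
  refine Summable.of_nonneg_of_le (fun n => ?_) (fun n => ?_)
    (summable_two_rpow_mul_rpow ht (q + 1))
  · have := Real.log_nonneg (one_le_pnat_cast n)
    positivity
  · have h1 := one_le_pnat_cast n
    have h2 : Real.log ((n : ℕ) : ℝ) ≤ ((n : ℕ) : ℝ) := by
      linarith [Real.log_le_sub_one_of_pos (by linarith : (0:ℝ) < ((n : ℕ) : ℝ))]
    rw [Real.rpow_add (by linarith), Real.rpow_one, mul_assoc, mul_comm (((n : ℕ) : ℝ) ^ q)]
    gcongr

lemma digitWeight_mul_eq (ξ t q : ℝ) (n : ℕ+) :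
    digitWeight ξ t q n * (Real.log ((n : ℕ) : ℝ) - ξ) =
      exp (-(q * ξ)) *
        (2:ℝ) ^ (-((n : ℕ) : ℝ) * t) * Real.log ((n : ℕ) : ℝ) * ((n : ℕ) : ℝ) ^ q
      - ξ * digitWeight ξ t q n := by
  rw [digitWeight_eq]; ring

lemma summable_digitWeight_mul (ξ : ℝ) {t : ℝ} (ht : 0 < t) (q : ℝ) :
    Summable fun n : ℕ+ => digitWeight ξ t q n * (Real.log ((n : ℕ) : ℝ) - ξ) := by
  simp only [digitWeight_mul_eq]
  refine Summable.sub ?_ ((summable_digitWeight ξ ht q).mul_left ξ)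
  simpa only [mul_assoc] using (summable_log_mul ht q).mul_left (exp (-(q * ξ)))

/-- The system of two equations is equivalent to a normalisation of the weights `digitWeight`
with mean value `ξ` of the logarithm. -/
lemma equations_iff (ξ : ℝ) {t : ℝ} (ht : 0 < t) (q : ℝ) :
    (Real.log (∑' n : ℕ+, (2:ℝ) ^ (-((n : ℕ) : ℝ) * t) * ((n : ℕ) : ℝ) ^ q) = q * ξ ∧
      (∑' n : ℕ+, (2:ℝ) ^ (-((n : ℕ) : ℝ) * t) * Real.log ((n : ℕ) : ℝ) * ((n : ℕ) : ℝ) ^ q) /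
        (∑' n : ℕ+, (2:ℝ) ^ (-((n : ℕ) : ℝ) * t) * ((n : ℕ) : ℝ) ^ q) = ξ) ↔
    (∑' n, digitWeight ξ t q n = 1 ∧
      ∑' n : ℕ+, digitWeight ξ t q n * (Real.log ((n : ℕ) : ℝ) - ξ) = 0) := by
  have hs := summable_two_rpow_mul_rpow ht q
  have hpos : 0 < ∑' n : ℕ+, (2:ℝ) ^ (-((n : ℕ) : ℝ) * t) * ((n : ℕ) : ℝ) ^ q :=
    hs.tsum_pos (fun n => by positivity) 1 (by positivity)
  have hl := summable_log_mul ht q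
  have e1 : ∑' n, digitWeight ξ t q n =
      exp (-(q * ξ)) * ∑' n : ℕ+, (2:ℝ) ^ (-((n : ℕ) : ℝ) * t) * ((n : ℕ) : ℝ) ^ q := by
    rw [← tsum_mul_left]
    exact tsum_congr fun n => digitWeight_eq ξ t q n
  have e2 : ∑' n : ℕ+, digitWeight ξ t q n * (Real.log ((n : ℕ) : ℝ) - ξ) =
      exp (-(q * ξ)) * (∑' n : ℕ+,
        (2:ℝ) ^ (-((n : ℕ) : ℝ) * t) * Real.log ((n : ℕ) : ℝ) * ((n : ℕ) : ℝ) ^ q)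
      - ξ * ∑' n, digitWeight ξ t q n := by
    rw [← tsum_mul_left, ← tsum_mul_left,
      ← (hl.mul_left _).tsum_sub ((summable_digitWeight ξ ht q).mul_left ξ)]
    exact tsum_congr fun n => by rw [digitWeight_mul_eq]; ring
  rw [e2, e1, div_eq_iff hpos.ne']
  generalize (∑' n : ℕ+, (2:ℝ) ^ (-((n : ℕ) : ℝ) * t) * ((n : ℕ) : ℝ) ^ q) = a at *
  generalize (∑' n : ℕ+,
    (2:ℝ) ^ (-((n : ℕ) : ℝ) * t) * Real.log ((n : ℕ) : ℝ) * ((n : ℕ) : ℝ) ^ q) = b at *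
  refine and_congr ?_ ?_
  · rw [Real.exp_neg, inv_mul_eq_one₀ (exp_ne_zero _)]
    exact ⟨fun h => by rw [← h, Real.exp_log hpos], fun h => by rw [← h, Real.log_exp]⟩
  · have := exp_pos (-(q * ξ))
    constructor
    · rintro rfl; ring
    · intro h
      have : exp (-(q * ξ)) * (b - ξ * a) = 0 := by linarith
      rcases mul_eq_zero.1 this with h | h
      · exact absurd h (exp_ne_zero _)
      · linarith

lemma digitWeight_lt_of_lt (ξ : ℝ) {t t' : ℝ} (h : t < t') (q : ℝ) (n : ℕ+) :
    digitWeight ξ t' q n < digitWeight ξ t q n := by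
  unfold digitWeight
  have := one_le_pnat_cast n
  refine mul_lt_mul_of_pos_right (Real.rpow_lt_rpow_of_exponent_lt (by norm_num) ?_) (exp_pos _)
  nlinarith

lemma tsum_digitWeight_lt_of_lt (ξ : ℝ) {t t' : ℝ} (ht : 0 < t) (h : t < t') (q : ℝ) :
    ∑' n, digitWeight ξ t' q n < ∑' n, digitWeight ξ t q n :=
  Summable.tsum_lt_tsum (i := 1) (fun n => (digitWeight_lt_of_lt ξ h q n).le)
    (digitWeight_lt_of_lt ξ h q 1) (summable_digitWeight ξ (ht.trans h) q)
    (summable_digitWeight ξ ht q)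

/-- Strict convexity of `q ↦ ∑ digitWeight ξ t q`, at a critical point. -/
lemma tsum_digitWeight_lt_of_critical {ξ t q q' : ℝ} (hξ : 0 < ξ) (ht : 0 < t)
    (h0 : ∑' n : ℕ+, digitWeight ξ t q n * (Real.log ((n : ℕ) : ℝ) - ξ) = 0) (hq : q' ≠ q) :
    ∑' n, digitWeight ξ t q n < ∑' n, digitWeight ξ t q' n := by
  have key : ∀ n : ℕ+, digitWeight ξ t q' n =
      digitWeight ξ t q n * exp ((q' - q) * (Real.log ((n : ℕ) : ℝ) - ξ)) := by
    intro n
    rw [digitWeight, digitWeight, mul_assoc, ← Real.exp_add]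
    ring_nf
  have hs := summable_digitWeight_mul ξ ht q
  have e : ∑' n, digitWeight ξ t q n = ∑' n : ℕ+, (digitWeight ξ t q n +
      (q' - q) * (digitWeight ξ t q n * (Real.log ((n : ℕ) : ℝ) - ξ))) := by
    rw [(summable_digitWeight ξ ht q).tsum_add (hs.mul_left _), tsum_mul_left, h0]; ring
  rw [e]
  refine Summable.tsum_lt_tsum (i := 1) (fun n => ?_) ?_
    ((summable_digitWeight ξ ht q).add (hs.mul_left _)) (summable_digitWeight ξ ht q')
  · rw [key]
    have := Real.add_one_le_exp ((q' - q) * (Real.log ((n : ℕ) : ℝ) - ξ))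
    have := digitWeight_pos ξ t q n
    nlinarith
  · rw [key]
    have hne : (q' - q) * (Real.log (((1 : ℕ+) : ℕ) : ℝ) - ξ) ≠ 0 :=
      mul_ne_zero (sub_ne_zero.2 hq) (by simp [hξ.ne'])
    have := Real.add_one_lt_exp hne
    have := digitWeight_pos ξ t q 1
    nlinarith

lemma solution_unique {ξ t q t' q' : ℝ} (hξ : 0 < ξ) (ht : 0 < t) (ht' : 0 < t')
    (h1 : ∑' n, digitWeight ξ t q n = 1)
    (h0 : ∑' n : ℕ+, digitWeight ξ t q n * (Real.log ((n : ℕ) : ℝ) - ξ) = 0)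
    (h1' : ∑' n, digitWeight ξ t' q' n = 1)
    (h0' : ∑' n : ℕ+, digitWeight ξ t' q' n * (Real.log ((n : ℕ) : ℝ) - ξ) = 0) :
    t' = t ∧ q' = q := by
  have le : ∀ {t q : ℝ}, 0 < t →
      ∑' n : ℕ+, digitWeight ξ t q n * (Real.log ((n : ℕ) : ℝ) - ξ) = 0 → ∀ q',
      ∑' n, digitWeight ξ t q n ≤ ∑' n, digitWeight ξ t q' n := by
    intro t q ht h0 q'
    by_cases h : q' = q
    · rw [h]
    · exact (tsum_digitWeight_lt_of_critical hξ ht h0 h).le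
  have htt : t' = t := by
    rcases lt_trichotomy t' t with h | h | h
    · have := tsum_digitWeight_lt_of_lt ξ ht' h q'
      have := le ht h0 q'
      linarith
    · exact h
    · have := tsum_digitWeight_lt_of_lt ξ ht h q
      have := le ht' h0' q
      linarith
  subst htt
  refine ⟨rfl, ?_⟩
  by_contra h
  have := tsum_digitWeight_lt_of_critical hξ ht h0 h
  linarith

lemma hasDerivAt_tsum_digitWeight {ξ t : ℝ} (hξ : 0 < ξ) (ht : 0 < t) (q : ℝ) :
    HasDerivAt (fun q => ∑' n, digitWeight ξ t q n)
      (∑' n : ℕ+, digitWeight ξ t q n * (Real.log ((n : ℕ) : ℝ) - ξ)) q := by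
  set u : ℕ+ → ℝ := fun n => digitWeight 0 t (q + 1) n * exp ((|q| + 1) * ξ) *
    Real.log ((n : ℕ) : ℝ) + digitWeight 0 t (q + 1) n * exp ((|q| + 1) * ξ) * ξ with hu
  have hus : Summable u := by
    refine Summable.add ?_ (((summable_digitWeight 0 ht (q + 1)).mul_right _).mul_right _)
    have := (summable_digitWeight_mul 0 ht (q + 1)).mul_right (exp ((|q| + 1) * ξ))
    refine this.congr fun n => ?_
    ring
  have hderiv : ∀ (n : ℕ+) (y : ℝ), HasDerivAt (fun q => digitWeight ξ t q n)
      (digitWeight ξ t y n * (Real.log ((n : ℕ) : ℝ) - ξ)) y := by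
    intro n y
    have h1 : HasDerivAt (fun q : ℝ => q * (Real.log ((n : ℕ) : ℝ) - ξ))
        (Real.log ((n : ℕ) : ℝ) - ξ) y := by
      simpa using (hasDerivAt_id y).mul_const (Real.log ((n : ℕ) : ℝ) - ξ)
    have h2 := (h1.exp).const_mul ((2:ℝ) ^ (-((n : ℕ) : ℝ) * t))
    simp only [← mul_assoc] at h2
    exact h2
  have hbound : ∀ (n : ℕ+) (y : ℝ), y ∈ Ioo (q - 1) (q + 1) →
      ‖digitWeight ξ t y n * (Real.log ((n : ℕ) : ℝ) - ξ)‖ ≤ u n := by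
    intro n y hy
    have hl := Real.log_nonneg (one_le_pnat_cast n)
    have hw : digitWeight ξ t y n ≤ digitWeight 0 t (q + 1) n * exp ((|q| + 1) * ξ) := by
      rw [digitWeight, digitWeight, mul_assoc, ← Real.exp_add]
      refine mul_le_mul_of_nonneg_left (Real.exp_le_exp.2 ?_) (by positivity)
      have h3 : y * Real.log ((n : ℕ) : ℝ) ≤ (q + 1) * Real.log ((n : ℕ) : ℝ) :=
        mul_le_mul_of_nonneg_right hy.2.le hl
      have h4 : -y * ξ ≤ (|q| + 1) * ξ :=
        mul_le_mul_of_nonneg_right (by linarith [hy.1, neg_abs_le q]) hξ.le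
      linarith
    have ha : |Real.log ((n : ℕ) : ℝ) - ξ| ≤ Real.log ((n : ℕ) : ℝ) + ξ := by
      rw [abs_le]; constructor <;> linarith
    rw [norm_mul, Real.norm_of_nonneg (digitWeight_pos ξ t y n).le, Real.norm_eq_abs]
    simp only [hu, ← mul_add]
    exact mul_le_mul hw ha (abs_nonneg _) ((digitWeight_pos ξ t y n).le.trans hw)
  have hq : q ∈ Ioo (q - 1) (q + 1) := ⟨by linarith, by linarith⟩
  exact hasDerivAt_tsum_of_isPreconnected (g := fun n q => digitWeight ξ t q n) hus
    isOpen_Ioo isPreconnected_Ioo (fun n y _ => hderiv n y) hbound hq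
    (summable_digitWeight ξ ht q) hq

lemma continuousAt_tsum_digitWeight (ξ : ℝ) {t : ℝ} (ht : 0 < t) (q : ℝ) :
    ContinuousAt (fun t => ∑' n, digitWeight ξ t q n) t := by
  have hc : ContinuousOn (fun t => ∑' n, digitWeight ξ t q n) (Ioi (t / 2)) := by
    refine continuousOn_tsum (fun n => ?_) (summable_digitWeight ξ (half_pos ht) q)
      (fun n s hs => ?_)
    · unfold digitWeight
      exact ((continuous_const.rpow (by fun_prop) (by simp)).mul continuous_const).continuousOn
    · rw [Real.norm_of_nonneg (digitWeight_pos ξ s q n).le]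
      exact (digitWeight_lt_of_lt ξ hs q n).le
  exact hc.continuousAt (Ioi_mem_nhds (by linarith))

lemma two_rpow_ge_half {n : ℕ+} {t : ℝ} (h : ((n : ℕ) : ℝ) * t ≤ 1) :
    1 / 2 ≤ (2:ℝ) ^ (-((n : ℕ) : ℝ) * t) := by
  have : (2:ℝ) ^ (-1 : ℝ) ≤ (2:ℝ) ^ (-((n : ℕ) : ℝ) * t) :=
    Real.rpow_le_rpow_of_exponent_le (by norm_num) (by linarith)
  rwa [Real.rpow_neg_one, inv_eq_one_div] at this

lemma exists_log_pnat_gt (ξ : ℝ) : ∃ N : ℕ+, ξ < Real.log ((N : ℕ) : ℝ) := by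
  obtain ⟨n, hn⟩ := exists_nat_gt (exp ξ)
  have h0 : 0 < n := by
    have : (0:ℝ) < n := (exp_pos ξ).trans hn
    exact_mod_cast this
  exact ⟨⟨n, h0⟩, by simpa using (Real.lt_log_iff_exp_lt (by exact_mod_cast h0)).2 hn⟩

/-- For small `t` the sum of the weights is uniformly larger than one. -/
lemma exists_lower_bound {ξ : ℝ} (hξ : 0 < ξ) :
    ∃ t₀ > 0, ∀ t q, 0 < t → ∑' n, digitWeight ξ t q n ≤ 1 → t₀ ≤ t := by
  obtain ⟨N, hN⟩ := exists_log_pnat_gt ξ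
  have hN1 := one_le_pnat_cast N
  refine ⟨min (1 / (((N : ℕ) : ℝ) + 2)) (min (1 / 4) ξ), by positivity, fun t q ht hle => ?_⟩
  by_contra! hlt
  obtain ⟨h1, h2, h3⟩ : t < 1 / (((N : ℕ) : ℝ) + 2) ∧ t < 1 / 4 ∧ t < ξ := by
    simpa only [lt_min_iff] using hlt
  rw [lt_div_iff₀ (by positivity)] at h1
  have hsum : ∀ F : Finset ℕ+, ∑ n ∈ F, digitWeight ξ t q n ≤ 1 := fun F =>
    ((summable_digitWeight ξ ht q).sum_le_tsum F
      fun n _ => (digitWeight_pos ξ t q n).le).trans hle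
  rcases le_or_gt 0 q with hq | hq
  · have hb : ∀ n : ℕ+, N ≤ n → (n : ℕ) ≤ (N : ℕ) + 2 → 1 / 2 ≤ digitWeight ξ t q n := by
      intro n hn hn'
      have hn'' : ((n : ℕ) : ℝ) ≤ ((N : ℕ) : ℝ) + 2 := by exact_mod_cast hn'
      have hnn : ((N : ℕ) : ℝ) ≤ ((n : ℕ) : ℝ) := by exact_mod_cast hn
      have := two_rpow_ge_half (n := n) (t := t) (by nlinarith)
      have hlog : Real.log ((N : ℕ) : ℝ) ≤ Real.log ((n : ℕ) : ℝ) :=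
        Real.log_le_log (by linarith) hnn
      have he : 1 ≤ exp (q * (Real.log ((n : ℕ) : ℝ) - ξ)) :=
        Real.one_le_exp (mul_nonneg hq (by linarith))
      rw [digitWeight]
      nlinarith
    have := hsum {N, N + 1, N + 2}
    rw [Finset.sum_insert (by simp [← PNat.coe_inj]), Finset.sum_insert (by simp),
      Finset.sum_singleton] at this
    have hb0 := hb N le_rfl (by simp)
    have hb1 := hb (N + 1) (by simp [← PNat.coe_le_coe]) (by simp)
    have hb2 := hb (N + 2) (by simp [← PNat.coe_le_coe]) (by simp)
    linarith
  · rcases le_or_gt (-1) q with hq1 | hq1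
    · have hb : ∀ n : ℕ+, (n : ℕ) ≤ 4 → 1 / (2 * ((n : ℕ) : ℝ)) ≤ digitWeight ξ t q n := by
        intro n hn
        have h1n := one_le_pnat_cast n
        have hn'' : ((n : ℕ) : ℝ) ≤ 4 := by exact_mod_cast hn
        have h5 := two_rpow_ge_half (n := n) (t := t) (by nlinarith)
        have h6 : ((n : ℕ) : ℝ) ^ (-1 : ℝ) ≤ ((n : ℕ) : ℝ) ^ q :=
          Real.rpow_le_rpow_of_exponent_le h1n hq1
        rw [Real.rpow_neg_one] at h6
        have h7 : 1 ≤ exp (-(q * ξ)) := Real.one_le_exp (by nlinarith)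
        rw [digitWeight_eq]
        calc 1 / (2 * ((n : ℕ) : ℝ)) = 1 * (1 / 2 * ((n : ℕ) : ℝ)⁻¹) := by
              field_simp
          _ ≤ _ := by gcongr
      have := hsum {1, 2, 3, 4}
      rw [Finset.sum_insert (by decide), Finset.sum_insert (by decide),
        Finset.sum_insert (by decide), Finset.sum_singleton] at this
      have hb1 := hb 1 (by decide)
      have hb2 := hb 2 (by decide)
      have hb3 := hb 3 (by decide)
      have hb4 := hb 4 (by decide)
      norm_num at hb1 hb2 hb3 hb4
      linarith
    · have := hsum {1}
      rw [Finset.sum_singleton, digitWeight, Real.rpow_def_of_pos (by norm_num), ← Real.exp_add,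
        ← not_lt] at this
      refine this (Real.one_lt_exp_iff.2 ?_)
      have hl2 := Real.log_two_lt_d9
      have hl0 := Real.log_pos (by norm_num : (1:ℝ) < 2)
      simp only [PNat.one_coe, Nat.cast_one, Real.log_one]
      nlinarith

lemma exists_bounds {ξ : ℝ} (hξ : 0 < ξ) :
    ∃ A B : ℝ, ∀ t q, 0 < t → t ≤ 1 → ∑' n, digitWeight ξ t q n ≤ 1 → q ∈ Icc A B := by
  obtain ⟨N, hN⟩ := exists_log_pnat_gt ξ
  refine ⟨-(Real.log 2 / ξ), Real.log 2 * ((N : ℕ) : ℝ) / (Real.log ((N : ℕ) : ℝ) - ξ),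
    fun t q ht ht1 hle => ?_⟩
  have hterm : ∀ n : ℕ+, q * (Real.log ((n : ℕ) : ℝ) - ξ) ≤ Real.log 2 * ((n : ℕ) : ℝ) := by
    intro n
    have h := ((summable_digitWeight ξ ht q).le_tsum n
      fun n _ => (digitWeight_pos ξ t q n).le).trans hle
    rw [digitWeight, Real.rpow_def_of_pos (by norm_num), ← Real.exp_add, Real.exp_le_one_iff] at h
    have hl0 := Real.log_pos (by norm_num : (1:ℝ) < 2)
    have h1 := one_le_pnat_cast n
    have : Real.log 2 * (((n : ℕ) : ℝ) * t) ≤ Real.log 2 * ((n : ℕ) : ℝ) := by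
      gcongr; nlinarith
    linarith
  constructor
  · have := hterm 1
    simp only [PNat.one_coe, Nat.cast_one, Real.log_one, mul_one] at this
    rw [neg_le, le_div_iff₀ hξ]
    linarith
  · rw [le_div_iff₀ (by linarith)]
    exact hterm N

lemma summable_le_one_iff (ξ : ℝ) {t : ℝ} (ht : 0 < t) (q : ℝ) :
    ∑' n, digitWeight ξ t q n ≤ 1 ↔ ∀ F : Finset ℕ+, ∑ n ∈ F, digitWeight ξ t q n ≤ 1 :=
  ⟨fun h F => ((summable_digitWeight ξ ht q).sum_le_tsum F
      fun n _ => (digitWeight_pos ξ t q n).le).trans h,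
    fun h => (summable_digitWeight ξ ht q).tsum_le_of_sum_le h⟩

lemma tsum_digitWeight_one_zero (ξ : ℝ) : ∑' n, digitWeight ξ 1 0 n = 1 := by
  have h : ∀ n : ℕ+, digitWeight ξ 1 0 n = (fun k : ℕ => (1 / 2 : ℝ) ^ (k + 1)) (n.natPred) := by
    intro n
    simp only [digitWeight, PNat.natPred_add_one]
    rw [zero_mul, Real.exp_zero, mul_one, mul_one, Real.rpow_neg (by norm_num), Real.rpow_natCast]
    simp
  rw [tsum_congr h]
  have := Equiv.pnatEquivNat.tsum_eq (fun k : ℕ => (1 / 2 : ℝ) ^ (k + 1))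
  simp only [Equiv.pnatEquivNat_apply] at this
  rw [this]
  simp only [pow_succ]
  rw [tsum_mul_right, tsum_geometric_two]
  norm_num

lemma solution_exists {ξ : ℝ} (hξ : 0 < ξ) :
    ∃ t q : ℝ, 0 < t ∧ t ≤ 1 ∧ ∑' n, digitWeight ξ t q n = 1 ∧
      ∑' n : ℕ+, digitWeight ξ t q n * (Real.log ((n : ℕ) : ℝ) - ξ) = 0 := by
  obtain ⟨t₀, ht₀, hlow⟩ := exists_lower_bound hξ
  obtain ⟨A, B, hAB⟩ := exists_bounds hξ
  set K : Set (ℝ × ℝ) := (Icc t₀ 1 ×ˢ Icc A B) ∩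
    ⋂ F : Finset ℕ+, {p | ∑ n ∈ F, digitWeight ξ p.1 p.2 n ≤ 1} with hK
  have hKc : IsCompact K := by
    refine (isCompact_Icc.prod isCompact_Icc).inter_right (isClosed_iInter fun F => ?_)
    refine isClosed_le (continuous_finsetSum _ fun n _ => ?_) continuous_const
    unfold digitWeight
    exact (continuous_const.rpow (by fun_prop) (by simp)).mul (by fun_prop)
  have hmem : ∀ t q, 0 < t → t ≤ 1 → ∑' n, digitWeight ξ t q n ≤ 1 → (t, q) ∈ K := by
    intro t q ht ht1 h
    exact ⟨⟨⟨hlow t q ht h, ht1⟩, hAB t q ht ht1 h⟩,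
      mem_iInter.2 fun F => (summable_le_one_iff ξ ht q).1 h F⟩
  have hne : K.Nonempty := ⟨_, hmem 1 0 one_pos le_rfl (tsum_digitWeight_one_zero ξ).le⟩
  obtain ⟨⟨t, q⟩, hp, hmin⟩ := hKc.exists_isMinOn hne continuous_fst.continuousOn
  have ht : 0 < t := ht₀.trans_le hp.1.1.1
  have ht1 : t ≤ 1 := hp.1.1.2
  have hle : ∑' n, digitWeight ξ t q n ≤ 1 :=
    (summable_le_one_iff ξ ht q).2 fun F => mem_iInter.1 hp.2 F
  have hge : ∀ q', 1 ≤ ∑' n, digitWeight ξ t q' n := by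
    intro q'
    by_contra! hlt
    have h1 := (continuousAt_tsum_digitWeight ξ ht q').eventually_lt_const hlt
    have h2 : ∀ᶠ s in nhdsWithin t (Iio t), 0 < s ∧ s < t ∧ ∑' n, digitWeight ξ s q' n < 1 := by
      filter_upwards [nhdsWithin_le_nhds h1, nhdsWithin_le_nhds (lt_mem_nhds ht),
        self_mem_nhdsWithin] with s a b c
      exact ⟨b, c, a⟩
    obtain ⟨s, hs0, hst, hs⟩ := h2.exists
    have : t ≤ s := hmin (hmem s q' hs0 (hst.le.trans ht1) hs.le)
    linarith
  refine ⟨t, q, ht, ht1, le_antisymm hle (hge q), ?_⟩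
  have hlm : IsLocalMin (fun q => ∑' n, digitWeight ξ t q n) q :=
    Eventually.of_forall fun p => hle.trans (hge p)
  exact hlm.hasDerivAt_eq_zero (hasDerivAt_tsum_digitWeight hξ ht q)

/-- The sum of the first `m` digits. -/
def digitSum (ω : ℕ → ℕ+) (m : ℕ) : ℕ := ∑ j ∈ Finset.range m, (ω j : ℕ)

/-- The point of `(0, 1]` with digit sequence `ω`. -/
noncomputable def coding (ω : ℕ → ℕ+) : ℝ := ∑' m, (1 / 2 : ℝ) ^ digitSum ω (m + 1)

lemma le_digitSum (ω : ℕ → ℕ+) (m : ℕ) : m ≤ digitSum ω m := by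
  simpa [digitSum] using
    Finset.card_nsmul_le_sum (Finset.range m) (fun j => (ω j : ℕ)) 1 fun j _ => (ω j).pos

lemma digitSum_succ (ω : ℕ → ℕ+) (m : ℕ) :
    digitSum ω (m + 1) = (ω 0 : ℕ) + digitSum (fun j => ω (j + 1)) m := by
  rw [digitSum, Finset.sum_range_succ', add_comm, digitSum]

lemma half_pow_digitSum_le (ω : ℕ → ℕ+) (m : ℕ) :
    (1 / 2 : ℝ) ^ digitSum ω (m + 1) ≤ (1 / 2 : ℝ) ^ m * (1 / 2) := by
  rw [← pow_succ]
  exact pow_le_pow_of_le_one (by norm_num) (by norm_num) (le_digitSum ω _)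

lemma summable_half_pow_mul_half : Summable fun m : ℕ => (1 / 2 : ℝ) ^ m * (1 / 2) :=
  summable_geometric_two.mul_right _

lemma summable_coding (ω : ℕ → ℕ+) : Summable fun m => (1 / 2 : ℝ) ^ digitSum ω (m + 1) :=
  Summable.of_nonneg_of_le (fun m => by positivity) (half_pow_digitSum_le ω)
    summable_half_pow_mul_half

lemma coding_pos (ω : ℕ → ℕ+) : 0 < coding ω :=
  (summable_coding ω).tsum_pos (fun m => by positivity) 0 (by positivity)

lemma coding_le_one (ω : ℕ → ℕ+) : coding ω ≤ 1 := by
  have h := (summable_coding ω).tsum_le_tsum (half_pow_digitSum_le ω) summable_half_pow_mul_half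
  rw [tsum_mul_right, tsum_geometric_two] at h
  norm_num at h
  simpa [coding] using h

lemma coding_eq (ω : ℕ → ℕ+) :
    coding ω = (1 / 2 : ℝ) ^ (ω 0 : ℕ) * (1 + coding fun j => ω (j + 1)) := by
  rw [coding, (summable_coding ω).tsum_eq_zero_add, mul_add, coding, ← tsum_mul_left]
  simp only [digitSum_succ ω, pow_add]
  simp [digitSum]

lemma half_pow_le_half (n : ℕ+) : (1 / 2 : ℝ) ^ (n : ℕ) ≤ 1 / 2 := by
  simpa using pow_le_pow_of_le_one (by norm_num : (0:ℝ) ≤ 1 / 2) (by norm_num) n.pos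

lemma eq_coding {x : ℕ → ℝ} {ω : ℕ → ℕ+} (hx : ∀ j, x j ∈ Ioc (0:ℝ) 1)
    (h : ∀ j, x j = (1 / 2 : ℝ) ^ (ω j : ℕ) * (1 + x (j + 1))) : x 0 = coding ω := by
  have key : ∀ m j, |x j - coding fun i => ω (j + i)| ≤ (1 / 2 : ℝ) ^ m := by
    intro m
    induction m with
    | zero =>
      intro j
      have h1 := coding_pos fun i => ω (j + i)
      have h2 := coding_le_one fun i => ω (j + i)
      rw [pow_zero, abs_le]
      constructor <;> linarith [(hx j).1, (hx j).2]
    | succ m ih =>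
      intro j
      have e : x j - (coding fun i => ω (j + i)) =
          (1 / 2 : ℝ) ^ (ω j : ℕ) * (x (j + 1) - coding fun i => ω (j + 1 + i)) := by
        rw [h j, coding_eq fun i => ω (j + i)]
        simp only [add_zero, add_assoc, add_comm 1]
        ring
      rw [e, abs_mul, abs_of_nonneg (by positivity), pow_succ, mul_comm]
      exact mul_le_mul (ih (j + 1)) (half_pow_le_half _) (by positivity) (by positivity)
  have hlim : Tendsto (fun m : ℕ => (1 / 2 : ℝ) ^ m) atTop (nhds 0) :=
    tendsto_pow_atTop_nhds_zero_of_lt_one (by norm_num) (by norm_num)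
  have := ge_of_tendsto' hlim fun m => key m 0
  simp only [zero_add] at this
  exact sub_eq_zero.1 (abs_nonpos_iff.1 this)

lemma abs_coding_sub_le (m : ℕ) : ∀ {ω ω' : ℕ → ℕ+}, (∀ j < m, ω j = ω' j) →
    |coding ω - coding ω'| ≤ (1 / 2 : ℝ) ^ digitSum ω m := by
  induction m with
  | zero =>
    intro ω ω' _
    simp only [digitSum, Finset.range_zero, Finset.sum_empty, pow_zero]
    rw [abs_le]
    constructor <;> linarith [coding_pos ω, coding_le_one ω, coding_pos ω', coding_le_one ω']
  | succ m ih =>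
    intro ω ω' h
    have h1 := ih (ω := fun j => ω (j + 1)) (ω' := fun j => ω' (j + 1))
      fun j hj => h (j + 1) (by omega)
    rw [digitSum_succ, pow_add, coding_eq ω, coding_eq ω', ← h 0 (by omega), ← mul_sub,
      add_sub_add_left_eq_sub, abs_mul, abs_of_nonneg (by positivity)]
    gcongr

lemma coding_tail_eq_one {ω : ℕ → ℕ+} (h : coding ω = 1) :
    ω 0 = 1 ∧ (coding fun j => ω (j + 1)) = 1 := by
  have h1 := coding_eq ω
  have h2 := coding_le_one fun j => ω (j + 1)
  have h3 := half_pow_le_half (ω 0)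
  have h4 := coding_pos fun j => ω (j + 1)
  have h5 : (coding fun j => ω (j + 1)) = 1 := by nlinarith
  refine ⟨?_, h5⟩
  rw [h5, h] at h1
  by_contra hne
  have h6 : 2 ≤ (ω 0 : ℕ) := by
    have := (ω 0).pos
    have : (ω 0 : ℕ) ≠ 1 := fun h => hne (PNat.coe_eq_one_iff.1 h)
    omega
  have := pow_le_pow_of_le_one (by norm_num : (0:ℝ) ≤ 1 / 2) (by norm_num) h6
  norm_num at h1 this
  linarith

lemma eq_one_of_coding_eq_one {ω : ℕ → ℕ+} (h : coding ω = 1) (i : ℕ) : ω i = 1 := by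
  induction i generalizing ω with
  | zero => exact (coding_tail_eq_one h).1
  | succ i ih => exact ih (coding_tail_eq_one h).2

lemma neg_logb_half_pow_mul {y : ℝ} (hy : 0 < y) (n : ℕ) :
    -Real.logb 2 ((1 / 2 : ℝ) ^ n * (1 + y)) = n - Real.logb 2 (1 + y) := by
  rw [Real.logb_mul (by positivity) (by positivity), Real.logb_pow, one_div, Real.logb_inv,
    Real.logb_self_eq_one (by norm_num)]
  ring

lemma p2gleT_half_pow_mul {y : ℝ} (hy : y ∈ Ioc (0:ℝ) 1) (n : ℕ) :
    p2gleT ((1 / 2 : ℝ) ^ n * (1 + y)) = y := by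
  have h0 : 0 < Real.logb 2 (1 + y) := Real.logb_pos (by norm_num) (by linarith [hy.1])
  have h1 : Real.logb 2 (1 + y) ≤ 1 := by
    rw [Real.logb_le_iff_le_rpow (by norm_num) (by linarith [hy.1])]
    norm_num; linarith [hy.2]
  have hf : ⌊-Real.logb 2 ((1 / 2 : ℝ) ^ n * (1 + y))⌋ = (n : ℤ) - 1 := by
    rw [neg_logb_half_pow_mul hy.1, Int.floor_eq_iff]
    push_cast
    constructor <;> linarith
  rw [p2gleT, hf, sub_add_cancel, zpow_natCast, ← mul_assoc, ← mul_pow]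
  norm_num

lemma ceil_neg_logb_half_pow_mul {y : ℝ} (hy : y ∈ Ioo (0:ℝ) 1) (n : ℕ) :
    ⌈-Real.logb 2 ((1 / 2 : ℝ) ^ n * (1 + y))⌉ = n := by
  have h0 : 0 < Real.logb 2 (1 + y) := Real.logb_pos (by norm_num) (by linarith [hy.1])
  have h1 : Real.logb 2 (1 + y) < 1 := by
    rw [Real.logb_lt_iff_lt_rpow (by norm_num) (by linarith [hy.1])]
    norm_num; linarith [hy.2]
  rw [neg_logb_half_pow_mul hy.1, Int.ceil_eq_iff]
  push_cast
  constructor <;> linarith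

lemma exists_eq_half_pow_mul {x : ℝ} (hx : x ∈ Ioc (0:ℝ) 1) :
    ∃ n : ℕ+, ∃ y ∈ Ioc (0:ℝ) 1, x = (1 / 2 : ℝ) ^ (n : ℕ) * (1 + y) := by
  obtain ⟨n, h1, h2⟩ := exists_nat_pow_near_of_lt_one hx.1 hx.2
    (by norm_num : (0:ℝ) < 1 / 2) (by norm_num)
  have hp : (0:ℝ) < (1 / 2) ^ (n + 1) := by positivity
  refine ⟨n.succPNat, x / (1 / 2) ^ (n + 1) - 1, ⟨?_, ?_⟩, ?_⟩
  · rw [sub_pos, lt_div_iff₀ hp]; linarith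
  · rw [sub_le_iff_le_add, div_le_iff₀ hp, pow_succ]; linarith
  · rw [Nat.succPNat_coe, Nat.succ_eq_add_one]
    field_simp
    ring

lemma exists_p2gle_step {x : ℝ} (hx : x ∈ Ioc (0:ℝ) 1) :
    p2gleT x ∈ Ioc (0:ℝ) 1 ∧ ∃ n : ℕ+, x = (1 / 2 : ℝ) ^ (n : ℕ) * (1 + p2gleT x) := by
  obtain ⟨n, y, hy, hxy⟩ := exists_eq_half_pow_mul hx
  have : p2gleT x = y := by rw [hxy, p2gleT_half_pow_mul hy]
  rw [this]
  exact ⟨hy, n, hxy⟩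

lemma p2gleT_one : p2gleT 1 = 1 := by norm_num [p2gleT]

lemma iterate_p2gleT_coding (ω : ℕ → ℕ+) (j : ℕ) :
    p2gleT^[j] (coding ω) = coding fun i => ω (j + i) := by
  induction j with
  | zero => simp
  | succ j ih =>
    rw [Function.iterate_succ_apply', ih, coding_eq fun i => ω (j + i),
      p2gleT_half_pow_mul ⟨coding_pos _, coding_le_one _⟩]
    simp only [add_assoc, add_comm 1]

lemma not_tendsto_average_of_eventually_zero {ξ : ℝ} (hξ : ξ ≠ 0) {a : ℕ → ℝ} {N : ℕ}
    (ha : ∀ i ≥ N, a i = 0) :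
    ¬ Tendsto (fun m : ℕ => (∑ j ∈ Finset.range m, a j) / m) atTop (nhds ξ) := by
  intro h
  have h0 : Tendsto a atTop (nhds 0) :=
    tendsto_const_nhds.congr' ((eventually_ge_atTop N).mono fun i hi => (ha i hi).symm)
  have h1 := h0.cesaro
  refine hξ (tendsto_nhds_unique (h.congr fun m => ?_) h1)
  rw [div_eq_inv_mul]

/-- The digit sequences whose logarithms have average `ξ`. -/
def logAverageSet (ξ : ℝ) : Set (ℕ → ℕ+) :=
  {ω | Tendsto (fun m : ℕ => (∑ j ∈ Finset.range m, Real.log ((ω j : ℕ) : ℝ)) / m)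
    atTop (nhds ξ)}

lemma logDigitLevelSet_eq_image {ξ : ℝ} (hξ : ξ ≠ 0) :
    logDigitLevelSet ξ = coding '' logAverageSet ξ := by
  ext x
  constructor
  · rintro ⟨hx, hlim⟩
    have hmem : ∀ j, p2gleT^[j] x ∈ Ioc (0:ℝ) 1 := by
      intro j
      induction j with
      | zero => exact hx
      | succ j ih =>
        rw [Function.iterate_succ_apply']
        exact (exists_p2gle_step ih).1
    have hne : ∀ j, p2gleT^[j] x ≠ 1 := by
      intro j hj
      refine not_tendsto_average_of_eventually_zero hξ (N := j) (fun i hi => ?_) hlim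
      obtain ⟨k, rfl⟩ := Nat.exists_eq_add_of_le' hi
      rw [p2gleD, Function.iterate_add_apply, hj, Function.iterate_fixed p2gleT_one]
      simp
    choose ω hω using fun j => (exists_p2gle_step (hmem j)).2
    simp only [← Function.iterate_succ_apply' p2gleT] at hω
    refine ⟨ω, ?_, (eq_coding hmem hω).symm⟩
    refine hlim.congr fun m => ?_
    congr 1
    refine Finset.sum_congr rfl fun j _ => ?_
    have : p2gleD j x = (ω j : ℕ) := by
      rw [p2gleD, hω j]
      exact ceil_neg_logb_half_pow_mul
        ⟨(hmem (j + 1)).1, lt_of_le_of_ne (hmem (j + 1)).2 (hne (j + 1))⟩ _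
    rw [this, Int.cast_natCast]
  · rintro ⟨ω, hω, rfl⟩
    refine ⟨⟨coding_pos ω, coding_le_one ω⟩, hω.congr fun m => ?_⟩
    congr 1
    refine Finset.sum_congr rfl fun j _ => ?_
    have hlt : (coding fun i => ω (j + (i + 1))) < 1 := by
      refine lt_of_le_of_ne (coding_le_one _) fun h1 => ?_
      refine not_tendsto_average_of_eventually_zero hξ (N := j + 1) (fun i hi => ?_) hω
      obtain ⟨k, rfl⟩ := Nat.exists_eq_add_of_le hi
      have := eq_one_of_coding_eq_one h1 k
      rw [show j + 1 + k = j + (k + 1) by ring, this]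
      simp
    have : p2gleD j (coding ω) = (ω j : ℕ) := by
      rw [p2gleD, iterate_p2gleT_coding, coding_eq fun i => ω (j + i)]
      exact ceil_neg_logb_half_pow_mul ⟨coding_pos _, hlt⟩ _
    rw [this, Int.cast_natCast]

/-- The sum of the logarithms of the first `m` digits. -/
noncomputable def logSum (ω : ℕ → ℕ+) (m : ℕ) : ℝ :=
  ∑ j ∈ Finset.range m, Real.log ((ω j : ℕ) : ℝ)

lemma prod_digitWeight (ξ t q : ℝ) (ω : ℕ → ℕ+) (m : ℕ) :
    ∏ j ∈ Finset.range m, digitWeight ξ t q (ω j) =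
      ((1 / 2 : ℝ) ^ digitSum ω m) ^ t * exp (q * (logSum ω m - m * ξ)) := by
  induction m with
  | zero => simp [digitSum, logSum]
  | succ m ih =>
    have h1 : digitSum ω (m + 1) = digitSum ω m + ω m := by
      rw [digitSum, Finset.sum_range_succ, digitSum]
    have h2 : logSum ω (m + 1) = logSum ω m + Real.log ((ω m : ℕ) : ℝ) := by
      rw [logSum, Finset.sum_range_succ, logSum]
    have h3 : (2:ℝ) ^ (-((ω m : ℕ) : ℝ) * t) = ((1 / 2 : ℝ) ^ (ω m : ℕ)) ^ t := by
      rw [Real.rpow_mul (by norm_num), Real.rpow_neg (by norm_num), Real.rpow_natCast, one_div,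
        inv_pow]
    rw [Finset.prod_range_succ, ih, h1, h2, digitWeight, h3, pow_add,
      Real.mul_rpow (by positivity) (by positivity)]
    have h4 : exp (q * (logSum ω m + Real.log ((ω m : ℕ) : ℝ) - ((m + 1 : ℕ) : ℝ) * ξ)) =
        exp (q * (logSum ω m - m * ξ)) * exp (q * (Real.log ((ω m : ℕ) : ℝ) - ξ)) := by
      rw [← Real.exp_add]
      congr 1
      push_cast
      ring
    rw [h4]
    ring

lemma ENNReal.tsum_fin_prod {α : Type*} (f : α → ENNReal) (m : ℕ) :
    ∑' w : Fin m → α, ∏ j, f (w j) = (∑' a, f a) ^ m := by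
  induction m with
  | zero => simp
  | succ m ih =>
    rw [← (Fin.consEquiv fun _ : Fin (m + 1) => α).tsum_eq, ENNReal.tsum_prod', pow_succ, ← ih]
    simp only [Fin.consEquiv_apply, Fin.prod_univ_succ, Fin.cons_zero, Fin.cons_succ]
    simp_rw [ENNReal.tsum_mul_left, ENNReal.tsum_mul_right]
    rw [mul_comm]

lemma ediam_coding_image_le {B : Set (ℕ → ℕ+)} {m : ℕ} {w : Fin m → ℕ+} {ω₀ : ℕ → ℕ+}
    (hω₀ : ∀ j : Fin m, ω₀ j = w j) :
    Metric.ediam (coding '' {ω ∈ B | ∀ j : Fin m, ω j = w j}) ≤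
      ENNReal.ofReal ((1 / 2 : ℝ) ^ digitSum ω₀ m) := by
  refine Metric.ediam_le ?_
  rintro _ ⟨ω, ⟨-, hω⟩, rfl⟩ _ ⟨ω', ⟨-, hω'⟩, rfl⟩
  rw [edist_dist, Real.dist_eq]
  refine ENNReal.ofReal_le_ofReal ?_
  have e : digitSum ω m = digitSum ω₀ m := by
    refine Finset.sum_congr rfl fun j hj => ?_
    rw [hω ⟨j, Finset.mem_range.1 hj⟩, hω₀ ⟨j, Finset.mem_range.1 hj⟩]
  rw [← e]
  exact abs_coding_sub_le m fun j hj => (hω ⟨j, hj⟩).trans (hω' ⟨j, hj⟩).symm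

/-- If the weights for the exponent `s` still sum to less than one after multiplication by
`e^{|q|ε}`, then the points whose digit averages are uniformly `ε`-close to `ξ` have zero
`s`-dimensional measure. -/
lemma hausdorffMeasure_uniform_eq_zero {ξ s q ε : ℝ} (hs : 0 < s)
    (hρ : (∑' n, digitWeight ξ s q n) * exp (|q| * ε) < 1) (M : ℕ) :
    Measure.hausdorffMeasure s
      (coding '' {ω | ∀ m ≥ M, |logSum ω m - m * ξ| ≤ m * ε}) = 0 := by
  set B : Set (ℕ → ℕ+) := {ω | ∀ m ≥ M, |logSum ω m - m * ξ| ≤ m * ε} with hB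
  set f : ℕ+ → ENNReal := fun n => ENNReal.ofReal (digitWeight ξ s q n * exp (|q| * ε)) with hf
  have hfs : ∑' n, f n < 1 := by
    rw [hf, ← ENNReal.ofReal_tsum_of_nonneg
      (fun n => mul_nonneg (digitWeight_pos ξ s q n).le (exp_pos _).le)
      ((summable_digitWeight ξ hs q).mul_right _), tsum_mul_right]
    simpa using ENNReal.ofReal_lt_one.2 hρ
  set c : ∀ m : ℕ, (Fin m → ℕ+) → Set ℝ :=
    fun m w => coding '' {ω ∈ B | ∀ j : Fin m, ω j = w j} with hc
  have hcover : ∀ m, coding '' B ⊆ ⋃ w, c m w := by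
    rintro m _ ⟨ω, hω, rfl⟩
    exact mem_iUnion.2 ⟨fun j => ω j, ω, ⟨hω, fun _ => rfl⟩, rfl⟩
  have hdiam : ∀ m (w : Fin m → ℕ+),
      Metric.ediam (c m w) ≤ ENNReal.ofReal ((1 / 2 : ℝ) ^ m) := by
    intro m w
    rcases (c m w).eq_empty_or_nonempty with h | ⟨_, ω, ⟨-, hω⟩, -⟩
    · simp [h]
    · refine (ediam_coding_image_le hω).trans (ENNReal.ofReal_le_ofReal ?_)
      exact pow_le_pow_of_le_one (by norm_num) (by norm_num) (le_digitSum ω m)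
  have hpow : ∀ m ≥ M, ∀ w : Fin m → ℕ+, Metric.ediam (c m w) ^ s ≤ ∏ j, f (w j) := by
    intro m hm w
    rcases (c m w).eq_empty_or_nonempty with h | ⟨_, ω, ⟨hωB, hω⟩, -⟩
    · simp [h, hs]
    · calc Metric.ediam (c m w) ^ s
          ≤ ENNReal.ofReal ((1 / 2 : ℝ) ^ digitSum ω m) ^ s := by
            gcongr; exact ediam_coding_image_le hω
        _ = ENNReal.ofReal (((1 / 2 : ℝ) ^ digitSum ω m) ^ s) :=
            ENNReal.ofReal_rpow_of_nonneg (by positivity) hs.le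
        _ ≤ ENNReal.ofReal (∏ j ∈ Finset.range m, digitWeight ξ s q (ω j) * exp (|q| * ε)) := by
            refine ENNReal.ofReal_le_ofReal ?_
            rw [Finset.prod_mul_distrib, prod_digitWeight, Finset.prod_const, Finset.card_range,
              ← Real.exp_nat_mul, mul_assoc, ← Real.exp_add]
            refine le_mul_of_one_le_right (by positivity) (Real.one_le_exp ?_)
            have h1 : |q * (logSum ω m - m * ξ)| ≤ |q| * (m * ε) := by
              rw [abs_mul]
              exact mul_le_mul_of_nonneg_left (hωB m hm) (abs_nonneg q)
            have := (abs_le.1 h1).1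
            linarith
        _ = ∏ j, f (w j) := by
            rw [ENNReal.ofReal_prod_of_nonneg fun j _ =>
              mul_nonneg (digitWeight_pos ξ s q _).le (exp_pos _).le, Finset.prod_range]
            exact Finset.prod_congr rfl fun j _ => by rw [hω j]
  have hr : Tendsto (fun m : ℕ => ENNReal.ofReal ((1 / 2 : ℝ) ^ m)) atTop (nhds 0) := by
    have := (ENNReal.continuous_ofReal.tendsto 0).comp
      (tendsto_pow_atTop_nhds_zero_of_lt_one (by norm_num : (0:ℝ) ≤ 1 / 2) (by norm_num))
    rw [ENNReal.ofReal_zero] at this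
    exact this
  have hlim : Tendsto (fun m => (∑' n, f n) ^ m) atTop (nhds 0) :=
    ENNReal.tendsto_pow_atTop_nhds_zero_of_lt_one hfs
  refine le_antisymm ?_ zero_le
  calc Measure.hausdorffMeasure s (coding '' B)
      ≤ liminf (fun m => ∑' w, Metric.ediam (c m w) ^ s) atTop :=
        Measure.hausdorffMeasure_le_liminf_tsum s _ _ hr c (Eventually.of_forall hdiam)
          (Eventually.of_forall hcover)
    _ ≤ liminf (fun m => (∑' n, f n) ^ m) atTop := by
        refine liminf_le_liminf ?_
        filter_upwards [eventually_ge_atTop M] with m hm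
        rw [← ENNReal.tsum_fin_prod]
        exact ENNReal.tsum_le_tsum (hpow m hm)
    _ = 0 := hlim.liminf_eq

lemma logAverageSet_subset (ξ : ℝ) {ε : ℝ} (hε : 0 < ε) :
    logAverageSet ξ ⊆ ⋃ M : ℕ, {ω | ∀ m ≥ M, |logSum ω m - m * ξ| ≤ m * ε} := by
  intro ω hω
  obtain ⟨M, hM⟩ := Metric.tendsto_atTop.1 hω ε hε
  refine mem_iUnion.2 ⟨M, fun m hm => ?_⟩
  rcases m.eq_zero_or_pos with rfl | hm0
  · simp [logSum]
  · have h := (hM m hm).le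
    have hm' : (0:ℝ) < m := by exact_mod_cast hm0
    have e : logSum ω m - m * ξ = m * (logSum ω m / m - ξ) := by field_simp
    rw [e, abs_mul, abs_of_pos hm']
    exact mul_le_mul_of_nonneg_left h hm'.le

lemma dimH_coding_image_le {ξ t q : ℝ} (ht : 0 < t) (h1 : ∑' n, digitWeight ξ t q n = 1) :
    dimH (coding '' logAverageSet ξ) ≤ ENNReal.ofReal t := by
  have key : ∀ s, t < s → dimH (coding '' logAverageSet ξ) ≤ ENNReal.ofReal s := by
    intro s hs
    have hs0 : 0 < s := ht.trans hs
    have hlt : ∑' n, digitWeight ξ s q n < 1 := h1 ▸ tsum_digitWeight_lt_of_lt ξ ht hs q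
    have hcont : Tendsto (fun ε : ℝ => (∑' n, digitWeight ξ s q n) * exp (|q| * ε))
        (nhdsWithin 0 (Ioi 0)) (nhds (∑' n, digitWeight ξ s q n)) := by
      have : Continuous fun ε : ℝ => (∑' n, digitWeight ξ s q n) * exp (|q| * ε) := by fun_prop
      simpa using (this.tendsto 0).mono_left nhdsWithin_le_nhds
    obtain ⟨ε, hε, hε0⟩ := ((hcont.eventually_lt_const hlt).and self_mem_nhdsWithin).exists
    refine (dimH_mono ((image_mono (logAverageSet_subset ξ hε0)).trans
      (image_iUnion ..).subset)).trans ?_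
    rw [dimH_iUnion]
    refine iSup_le fun M => ?_
    have := hausdorffMeasure_uniform_eq_zero hs0 hε M
    refine dimH_le_of_hausdorffMeasure_ne_top (d := s.toNNReal) ?_
    rw [Real.coe_toNNReal s hs0.le, this]
    exact ENNReal.zero_ne_top
  have hlim : Tendsto ENNReal.ofReal (nhdsWithin t (Ioi t)) (nhds (ENNReal.ofReal t)) :=
    (ENNReal.continuous_ofReal.tendsto t).mono_left nhdsWithin_le_nhds
  exact ge_of_tendsto hlim (eventually_nhdsWithin_of_forall key)

instance : MeasurableSpace ℕ+ := ⊤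

instance : DiscreteMeasurableSpace ℕ+ := ⟨fun _ => trivial⟩

/-- The distribution on the digits given by weights of total mass one. -/
noncomputable def digitPMF {ξ t q : ℝ} (ht : 0 < t) (h1 : ∑' n, digitWeight ξ t q n = 1) :
    PMF ℕ+ :=
  ⟨fun n => ENNReal.ofReal (digitWeight ξ t q n), by
    have := (summable_digitWeight ξ ht q).hasSum
    rw [h1] at this
    have h2 := ENNReal.hasSum_coe.2 (this.toNNReal fun n => (digitWeight_pos ξ t q n).le)
    rw [Real.toNNReal_one, ENNReal.coe_one] at h2
    exact h2⟩

/-- The Bernoulli measure on digit sequences with marginals `digitPMF`. -/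
noncomputable def digitMeasure {ξ t q : ℝ} (ht : 0 < t) (h1 : ∑' n, digitWeight ξ t q n = 1) :
    Measure (ℕ → ℕ+) :=
  Measure.infinitePi fun _ : ℕ => (digitPMF ht h1).toMeasure

section Bernoulli

variable {ξ t q : ℝ} (ht : 0 < t) (h1 : ∑' n, digitWeight ξ t q n = 1)

instance : IsProbabilityMeasure (digitMeasure ht h1) := by
  unfold digitMeasure; infer_instance

lemma digitPMF_apply (n : ℕ+) : digitPMF ht h1 n = ENNReal.ofReal (digitWeight ξ t q n) := rfl

lemma digitPMF_toMeasure_singleton (n : ℕ+) :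
    (digitPMF ht h1).toMeasure {n} = ENNReal.ofReal (digitWeight ξ t q n) := by
  rw [PMF.toMeasure_apply_singleton _ _ (MeasurableSet.singleton n), digitPMF_apply]

lemma summable_digitWeight_mul_log (ξ : ℝ) {t : ℝ} (ht : 0 < t) (q : ℝ) :
    Summable fun n : ℕ+ => digitWeight ξ t q n * Real.log ((n : ℕ) : ℝ) := by
  refine ((summable_digitWeight_mul ξ ht q).add
    ((summable_digitWeight ξ ht q).mul_right ξ)).congr fun n => ?_
  ring

lemma integrable_log_digitPMF :
    Integrable (fun n : ℕ+ => Real.log ((n : ℕ) : ℝ)) (digitPMF ht h1).toMeasure := by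
  refine ⟨(measurable_of_countable _).aestronglyMeasurable, ?_⟩
  rw [hasFiniteIntegral_iff_enorm, lintegral_countable']
  have e : ∀ n : ℕ+, ‖Real.log ((n : ℕ) : ℝ)‖ₑ * (digitPMF ht h1).toMeasure {n} =
      ENNReal.ofReal (digitWeight ξ t q n * Real.log ((n : ℕ) : ℝ)) := by
    intro n
    have hl := Real.log_nonneg (one_le_pnat_cast n)
    rw [digitPMF_toMeasure_singleton, Real.enorm_eq_ofReal hl, ← ENNReal.ofReal_mul hl, mul_comm]
  rw [tsum_congr e]
  exact (summable_digitWeight_mul_log ξ ht q).tsum_ofReal_lt_top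

lemma integral_log_digitPMF
    (h0 : ∑' n : ℕ+, digitWeight ξ t q n * (Real.log ((n : ℕ) : ℝ) - ξ) = 0) :
    ∫ n : ℕ+, Real.log ((n : ℕ) : ℝ) ∂(digitPMF ht h1).toMeasure = ξ := by
  rw [PMF.integral_eq_tsum _ _ (integrable_log_digitPMF ht h1)]
  have e : ∀ n : ℕ+, ((digitPMF ht h1) n).toReal • Real.log ((n : ℕ) : ℝ) =
      digitWeight ξ t q n * (Real.log ((n : ℕ) : ℝ) - ξ) + digitWeight ξ t q n * ξ := by
    intro n
    rw [digitPMF_apply, ENNReal.toReal_ofReal (digitWeight_pos ξ t q n).le, smul_eq_mul]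
    ring
  rw [tsum_congr e, (summable_digitWeight_mul ξ ht q).tsum_add
    ((summable_digitWeight ξ ht q).mul_right ξ), h0, tsum_mul_right, h1]
  ring

lemma ae_mem_logAverageSet
    (h0 : ∑' n : ℕ+, digitWeight ξ t q n * (Real.log ((n : ℕ) : ℝ) - ξ) = 0) :
    logAverageSet ξ ∈ ae (digitMeasure ht h1) := by
  set X : ℕ → (ℕ → ℕ+) → ℝ := fun i ω => Real.log ((ω i : ℕ) : ℝ) with hX
  have hm : Measurable fun n : ℕ+ => Real.log ((n : ℕ) : ℝ) := measurable_of_countable _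
  have hmp : ∀ i, MeasurePreserving (Function.eval i) (digitMeasure ht h1)
      (digitPMF ht h1).toMeasure := fun i => measurePreserving_eval_infinitePi _ i
  have hXm : ∀ i, Measurable (X i) := fun i => hm.comp (measurable_pi_apply i)
  have hmap : ∀ i, (digitMeasure ht h1).map (X i) =
      (digitPMF ht h1).toMeasure.map fun n : ℕ+ => Real.log ((n : ℕ) : ℝ) := by
    intro i
    rw [← (hmp i).map_eq, Measure.map_map hm (measurable_pi_apply i)]
    rfl
  have hint : Integrable (X 0) (digitMeasure ht h1) :=
    ((hmp 0).integrable_comp hm.aestronglyMeasurable).2 (integrable_log_digitPMF ht h1)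
  have hindep : ProbabilityTheory.iIndepFun X (digitMeasure ht h1) :=
    ProbabilityTheory.iIndepFun_infinitePi
      (X := fun _ (n : ℕ+) => Real.log ((n : ℕ) : ℝ)) fun _ => hm
  have hslln := ProbabilityTheory.strong_law_ae_real X hint
    (fun i j hij => hindep.indepFun hij)
    (fun i => ⟨(hXm i).aemeasurable, (hXm 0).aemeasurable, by rw [hmap i, hmap 0]⟩)
  have hmean : ∫ ω, X 0 ω ∂(digitMeasure ht h1) = ξ := by
    refine Eq.trans ?_ (integral_log_digitPMF ht h1 h0)
    rw [← (hmp 0).map_eq, integral_map (measurable_pi_apply 0).aemeasurable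
      hm.aestronglyMeasurable]
  rw [hmean] at hslln
  exact hslln

lemma digitWeight_eq_mul (ξ t q s : ℝ) (n : ℕ+) :
    digitWeight ξ t q n = ((1 / 2 : ℝ) ^ (n : ℕ)) ^ s * digitWeight ξ (t - s) q n := by
  rw [digitWeight, digitWeight, ← mul_assoc]
  congr 1
  rw [one_div, inv_pow, ← Real.rpow_natCast, ← Real.rpow_neg (by norm_num),
    ← Real.rpow_mul (by norm_num), ← Real.rpow_add (by norm_num)]
  congr 1
  ring

lemma digitPMF_tail_le {s : ℝ} (hs : 0 < s) (hst : s < t) (r : ℕ) :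
    (digitPMF ht h1).toMeasure {n | r < (n : ℕ)} ≤
      ENNReal.ofReal (((1 / 2 : ℝ) ^ r) ^ s * ∑' n, digitWeight ξ (t - s) q n) := by
  have hsum := summable_digitWeight ξ (sub_pos.2 hst) q
  rw [PMF.toMeasure_apply_eq_tsum, ← tsum_mul_left, ENNReal.ofReal_tsum_of_nonneg
    (fun n => mul_nonneg (by positivity) (digitWeight_pos ξ (t - s) q n).le) (hsum.mul_left _)]
  refine ENNReal.tsum_le_tsum fun n => ?_
  by_cases hn : r < (n : ℕ)
  · rw [indicator_of_mem (by exact hn), digitPMF_apply, digitWeight_eq_mul ξ t q s]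
    refine ENNReal.ofReal_le_ofReal (mul_le_mul_of_nonneg_right ?_
      (digitWeight_pos ξ (t - s) q n).le)
    exact Real.rpow_le_rpow (by positivity)
      (pow_le_pow_of_le_one (by norm_num) (by norm_num) hn.le) hs.le
  · rw [indicator_of_notMem (by exact hn)]
    exact zero_le

lemma digitMeasure_cylinder (w : ℕ → ℕ+) (m r : ℕ) :
    digitMeasure ht h1 {ω | (∀ j < m, ω j = w j) ∧ r < (ω m : ℕ)} =
      ENNReal.ofReal (∏ j ∈ Finset.range m, digitWeight ξ t q (w j)) *
        (digitPMF ht h1).toMeasure {n | r < (n : ℕ)} := by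
  have e : {ω : ℕ → ℕ+ | (∀ j < m, ω j = w j) ∧ r < (ω m : ℕ)} =
      Set.pi (Finset.range (m + 1))
        fun j => if j < m then {w j} else {n : ℕ+ | r < (n : ℕ)} := by
    ext ω
    simp only [Finset.coe_range, Set.mem_pi, mem_ofPred_eq, mem_Iio]
    constructor
    · rintro ⟨ha, hb⟩ j hj
      split_ifs with h
      · exact ha j h
      · obtain rfl : j = m := by omega
        exact hb
    · intro h
      refine ⟨fun j hj => ?_, ?_⟩
      · simpa [hj] using h j (by omega)
      · simpa using h m (by omega)
  rw [e, digitMeasure, Measure.infinitePi_pi _ fun _ _ => MeasurableSet.of_discrete,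
    Finset.prod_range_succ, ENNReal.ofReal_prod_of_nonneg fun j _ => (digitWeight_pos ξ t q _).le]
  congr 1
  · refine Finset.prod_congr rfl fun j hj => ?_
    rw [if_pos (Finset.mem_range.1 hj), digitPMF_toMeasure_singleton]
  · simp

end Bernoulli

lemma ceil_coding_of_lt {ω : ℕ → ℕ+} {k : ℕ} (h : k < (ω 0 : ℕ)) :
    ⌈(2:ℝ) ^ k * coding ω⌉ = 1 := by
  have h2 := coding_pos fun j => ω (j + 1)
  have h3 := coding_le_one fun j => ω (j + 1)
  have h4 : (1 / 2 : ℝ) ^ (ω 0 : ℕ) ≤ (1 / 2) ^ (k + 1) :=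
    pow_le_pow_of_le_one (by norm_num) (by norm_num) h
  have h5 : (2:ℝ) ^ k * (1 / 2) ^ k = 1 := by rw [← mul_pow]; norm_num
  rw [Int.ceil_eq_iff]
  have h6 := coding_pos ω
  refine ⟨by simpa using h6, ?_⟩
  rw [coding_eq ω]
  calc (2:ℝ) ^ k * ((1 / 2) ^ (ω 0 : ℕ) * (1 + coding fun j => ω (j + 1)))
      ≤ 2 ^ k * ((1 / 2) ^ (k + 1) * (1 + 1)) := by gcongr
    _ = 2 ^ k * (1 / 2) ^ k := by rw [pow_succ]; ring
    _ = ((1 : ℤ) : ℝ) := by rw [h5]; simp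

lemma ceil_coding_of_eq_add {ω : ℕ → ℕ+} {k l : ℕ} (h : k = (ω 0 : ℕ) + l) :
    ⌈(2:ℝ) ^ k * coding ω⌉ = 2 ^ l + ⌈(2:ℝ) ^ l * coding fun j => ω (j + 1)⌉ := by
  have h5 : (2:ℝ) ^ (ω 0 : ℕ) * (1 / 2) ^ (ω 0 : ℕ) = 1 := by rw [← mul_pow]; norm_num
  have e : (2:ℝ) ^ k * coding ω =
      ((2 ^ l : ℤ) : ℝ) + (2:ℝ) ^ l * coding fun j => ω (j + 1) := by
    rw [coding_eq ω, h, pow_add]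
    push_cast
    linear_combination (2 ^ l * (1 + coding fun j => ω (j + 1))) * h5
  rw [e, Int.ceil_intCast_add]

lemma ceil_coding_pos (ω : ℕ → ℕ+) (k : ℕ) : 1 ≤ ⌈(2:ℝ) ^ k * coding ω⌉ :=
  Int.one_le_ceil_iff.2 (mul_pos (by positivity) (coding_pos ω))

lemma ceil_coding_le (ω : ℕ → ℕ+) (k : ℕ) : ⌈(2:ℝ) ^ k * coding ω⌉ ≤ 2 ^ k := by
  rw [Int.ceil_le]
  push_cast
  exact mul_le_of_le_one_right (by positivity) (coding_le_one ω)

lemma le_of_ceil_coding_eq {ω ω' : ℕ → ℕ+} {k : ℕ} (hk : (ω 0 : ℕ) ≤ k)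
    (h : ⌈(2:ℝ) ^ k * coding ω⌉ = ⌈(2:ℝ) ^ k * coding ω'⌉) : (ω' 0 : ℕ) ≤ (ω 0 : ℕ) := by
  obtain ⟨l, hl⟩ := Nat.exists_eq_add_of_le hk
  rw [ceil_coding_of_eq_add hl] at h
  have h2 := ceil_coding_pos (fun j => ω (j + 1)) l
  have hp : (1 : ℤ) ≤ 2 ^ l := one_le_pow₀ (by norm_num)
  by_contra! hlt
  rcases lt_or_ge k (ω' 0 : ℕ) with h3 | h3
  · rw [ceil_coding_of_lt h3] at h
    linarith
  · obtain ⟨l', hl'⟩ := Nat.exists_eq_add_of_le h3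
    rw [ceil_coding_of_eq_add hl'] at h
    have h4 := ceil_coding_le (fun j => ω' (j + 1)) l'
    have h5 : (2 : ℤ) ^ (l' + 1) ≤ 2 ^ l := pow_le_pow_right₀ (by norm_num) (by omega)
    rw [pow_succ] at h5
    linarith

/-- Sequences coding points of the same dyadic interval of generation `k` share the digits whose
partial sums do not exceed `k`. -/
lemma agree_of_ceil_coding_eq (m : ℕ) : ∀ {k : ℕ} {ω ω' : ℕ → ℕ+}, digitSum ω m ≤ k →
    k < digitSum ω (m + 1) → ⌈(2:ℝ) ^ k * coding ω⌉ = ⌈(2:ℝ) ^ k * coding ω'⌉ →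
    (∀ j < m, ω' j = ω j) ∧ k - digitSum ω m < (ω' m : ℕ) := by
  induction m with
  | zero =>
    intro k ω ω' _ hk h
    refine ⟨by simp, ?_⟩
    have hk' : k < (ω 0 : ℕ) := by simpa [digitSum] using hk
    by_contra! hle
    have hle' : (ω' 0 : ℕ) ≤ k := by simpa [digitSum] using hle
    have := le_of_ceil_coding_eq hle' h.symm
    omega
  | succ m ih =>
    intro k ω ω' hk hk' h
    rw [digitSum_succ] at hk hk'
    have hle := le_of_ceil_coding_eq (by omega) h
    have hge := le_of_ceil_coding_eq (by omega) h.symm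
    have h0 : (ω' 0 : ℕ) = (ω 0 : ℕ) := le_antisymm hle hge
    obtain ⟨l, hl⟩ := Nat.exists_eq_add_of_le (show (ω 0 : ℕ) ≤ k by omega)
    rw [ceil_coding_of_eq_add hl,
      ceil_coding_of_eq_add (ω := ω') (l := l) (by rw [h0]; exact hl), add_right_inj] at h
    obtain ⟨ha, hb⟩ := ih (k := l) (by omega) (by omega) h
    refine ⟨fun j hj => ?_, ?_⟩
    · cases j with
      | zero => exact PNat.coe_injective h0
      | succ j => exact ha j (by omega)
    · rw [digitSum_succ]
      omega

lemma exists_digitSum_le_lt (ω : ℕ → ℕ+) (k : ℕ) :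
    ∃ m, digitSum ω m ≤ k ∧ k < digitSum ω (m + 1) := by
  have hex : ∃ m, k < digitSum ω (m + 1) := ⟨k, le_digitSum ω (k + 1)⟩
  classical
  refine ⟨Nat.find hex, ?_, Nat.find_spec hex⟩
  rcases h : Nat.find hex with _ | m
  · simp [digitSum]
  · exact not_lt.1 (Nat.find_min hex (m := m) (by omega))

lemma measurable_coding : Measurable coding := by
  have hm : ∀ m, Measurable fun ω : ℕ → ℕ+ => (1 / 2 : ℝ) ^ digitSum ω m := by
    intro m
    have : Measurable fun ω : ℕ → ℕ+ => digitSum ω m := by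
      unfold digitSum
      exact Finset.measurable_sum _ fun j _ =>
        (measurable_of_countable fun n : ℕ+ => (n : ℕ)).comp (measurable_pi_apply j)
    exact (measurable_of_countable fun n : ℕ => (1 / 2 : ℝ) ^ n).comp this
  refine measurable_of_tendsto_metrizable
    (f := fun N ω => ∑ m ∈ Finset.range N, (1 / 2 : ℝ) ^ digitSum ω (m + 1))
    (fun N => Finset.measurable_sum _ fun m _ => hm (m + 1)) ?_
  rw [tendsto_pi_nhds]
  exact fun ω => (summable_coding ω).hasSum.tendsto_sum_nat

/-- The sequences along which `q (logSum - mξ)` is bounded by `ε m + M`. -/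
def controlledSet (ξ q ε : ℝ) (M : ℕ) : Set (ℕ → ℕ+) :=
  {ω | ∀ m : ℕ, q * (logSum ω m - m * ξ) ≤ ε * m + M}

lemma measurableSet_controlledSet (ξ q ε : ℝ) (M : ℕ) :
    MeasurableSet (controlledSet ξ q ε M) := by
  have hl : ∀ m, Measurable fun ω : ℕ → ℕ+ => logSum ω m := fun m =>
    Finset.measurable_sum _ fun j _ =>
      (measurable_of_countable fun n : ℕ+ => Real.log ((n : ℕ) : ℝ)).comp (measurable_pi_apply j)
  rw [controlledSet, ofPred_forall]
  exact MeasurableSet.iInter fun m =>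
    measurableSet_le (((hl m).sub_const _).const_mul q) measurable_const

lemma logAverageSet_subset_iUnion_controlledSet (ξ q : ℝ) {ε : ℝ} (hε : 0 < ε) :
    logAverageSet ξ ⊆ ⋃ M : ℕ, controlledSet ξ q ε M := by
  intro ω hω
  have hq : 0 < |q| + 1 := by positivity
  obtain ⟨M₀, hM₀⟩ := mem_iUnion.1 (logAverageSet_subset ξ (div_pos hε hq) hω)
  obtain ⟨M, hM⟩ := exists_nat_ge (∑ m ∈ Finset.range M₀, |q * (logSum ω m - m * ξ)|)
  refine mem_iUnion.2 ⟨M, fun m => ?_⟩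
  rcases lt_or_ge m M₀ with hm | hm
  · have h1 : |q * (logSum ω m - m * ξ)| ≤ M :=
      (Finset.single_le_sum (f := fun m : ℕ => |q * (logSum ω m - m * ξ)|)
        (fun _ _ => abs_nonneg _) (Finset.mem_range.2 hm)).trans hM
    have := le_abs_self (q * (logSum ω m - m * ξ))
    have : 0 ≤ ε * m := by positivity
    linarith
  · have h1 : |q * (logSum ω m - m * ξ)| ≤ (|q| + 1) * (m * (ε / (|q| + 1))) := by
      rw [abs_mul]
      exact mul_le_mul (by linarith) (hM₀ m hm) (abs_nonneg _) hq.le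
    have h2 : (|q| + 1) * (m * (ε / (|q| + 1))) = ε * m := by field_simp
    have := le_abs_self (q * (logSum ω m - m * ξ))
    have : (0:ℝ) ≤ M := by positivity
    linarith

section LowerBound

variable {ξ t q : ℝ} (ht : 0 < t) (h1 : ∑' n, digitWeight ξ t q n = 1)

lemma prod_digitWeight_le {s : ℝ} {M : ℕ} (hst : s < t) {ω : ℕ → ℕ+}
    (hω : ω ∈ controlledSet ξ q ((t - s) * Real.log 2) M) (m : ℕ) :
    ∏ j ∈ Finset.range m, digitWeight ξ t q (ω j) ≤
      exp M * ((1 / 2 : ℝ) ^ digitSum ω m) ^ s := by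
  have hb : (0:ℝ) < (1 / 2 : ℝ) ^ digitSum ω m := by positivity
  have hl := Real.log_pos (by norm_num : (1:ℝ) < 2)
  have hlog : Real.log ((1 / 2 : ℝ) ^ digitSum ω m) = -(digitSum ω m * Real.log 2) := by
    rw [Real.log_pow, one_div, Real.log_inv]; ring
  have hm : (m : ℝ) ≤ digitSum ω m := by exact_mod_cast le_digitSum ω m
  rw [prod_digitWeight, Real.rpow_def_of_pos hb, Real.rpow_def_of_pos hb, ← Real.exp_add,
    ← Real.exp_add, hlog]
  refine Real.exp_le_exp.2 ?_
  have h1 := hω m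
  have h2 : (t - s) * Real.log 2 * m ≤ (t - s) * Real.log 2 * digitSum ω m :=
    mul_le_mul_of_nonneg_left hm (mul_nonneg (by linarith) hl.le)
  nlinarith

lemma digitMeasure_dyadic_le {s : ℝ} (hs : 0 < s) (hst : s < t) (M k : ℕ) (c : ℤ) :
    digitMeasure ht h1 ({ω | ⌈(2:ℝ) ^ k * coding ω⌉ = c} ∩
        controlledSet ξ q ((t - s) * Real.log 2) M) ≤
      ENNReal.ofReal (exp M * (∑' n, digitWeight ξ (t - s) q n) * ((1 / 2 : ℝ) ^ k) ^ s) := by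
  rcases ({ω | ⌈(2:ℝ) ^ k * coding ω⌉ = c} ∩
    controlledSet ξ q ((t - s) * Real.log 2) M).eq_empty_or_nonempty with h | ⟨ω, hω, hωM⟩
  · simp [h]
  obtain ⟨m, hm, hm'⟩ := exists_digitSum_le_lt ω k
  have hsub : {ω | ⌈(2:ℝ) ^ k * coding ω⌉ = c} ∩ controlledSet ξ q ((t - s) * Real.log 2) M ⊆
      {ω' | (∀ j < m, ω' j = ω j) ∧ k - digitSum ω m < (ω' m : ℕ)} := by
    rintro ω' ⟨hω', -⟩
    have e : ⌈(2:ℝ) ^ k * coding ω⌉ = c := hω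
    have e' : ⌈(2:ℝ) ^ k * coding ω'⌉ = c := hω'
    exact agree_of_ceil_coding_eq m hm hm' (e.trans e'.symm)
  refine (measure_mono hsub).trans ?_
  rw [digitMeasure_cylinder]
  refine (mul_le_mul' (ENNReal.ofReal_le_ofReal (prod_digitWeight_le hst hωM m))
    (digitPMF_tail_le ht h1 hs hst _)).trans ?_
  rw [← ENNReal.ofReal_mul (by positivity)]
  refine ENNReal.ofReal_le_ofReal (le_of_eq ?_)
  have e : (1 / 2 : ℝ) ^ k = (1 / 2 : ℝ) ^ digitSum ω m * (1 / 2 : ℝ) ^ (k - digitSum ω m) := by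
    rw [← pow_add, Nat.add_sub_cancel' hm]
  rw [e, Real.mul_rpow (by positivity) (by positivity)]
  ring

lemma measurable_ceil_two_pow_mul (k : ℕ) : Measurable fun x : ℝ => ⌈(2:ℝ) ^ k * x⌉ :=
  Int.measurable_ceil.comp (measurable_const_mul _)

lemma exists_ceil_cover {U : Set ℝ} {k : ℕ}
    (hU : Metric.ediam U ≤ ENNReal.ofReal ((1 / 2 : ℝ) ^ k)) :
    ∃ c : ℤ, U ⊆ ⋃ i : Fin 3, {x : ℝ | ⌈(2:ℝ) ^ k * x⌉ = c + i} := by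
  rcases U.eq_empty_or_nonempty with rfl | ⟨x, hx⟩
  · simp
  refine ⟨⌈(2:ℝ) ^ k * x⌉ - 1, fun y hy => ?_⟩
  have h := (Metric.edist_le_ediam_of_mem hx hy).trans hU
  rw [edist_dist, ENNReal.ofReal_le_ofReal_iff (by positivity), Real.dist_eq] at h
  have h5 : (2:ℝ) ^ k * (1 / 2) ^ k = 1 := by rw [← mul_pow]; norm_num
  have h6 : |(2:ℝ) ^ k * x - 2 ^ k * y| ≤ 1 := by
    rw [← mul_sub, abs_mul, abs_of_nonneg (by positivity), ← h5]
    gcongr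
  obtain ⟨ha, hb⟩ := abs_le.1 h6
  have h7 : ⌈(2:ℝ) ^ k * y⌉ ≤ ⌈(2:ℝ) ^ k * x⌉ + 1 := by
    rw [Int.ceil_le]; push_cast; linarith [Int.le_ceil ((2:ℝ) ^ k * x)]
  have h8 : ⌈(2:ℝ) ^ k * x⌉ ≤ ⌈(2:ℝ) ^ k * y⌉ + 1 := by
    rw [Int.ceil_le]; push_cast; linarith [Int.le_ceil ((2:ℝ) ^ k * y)]
  obtain h | h | h : ⌈(2:ℝ) ^ k * y⌉ = ⌈(2:ℝ) ^ k * x⌉ - 1 + 0 ∨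
      ⌈(2:ℝ) ^ k * y⌉ = ⌈(2:ℝ) ^ k * x⌉ - 1 + 1 ∨
      ⌈(2:ℝ) ^ k * y⌉ = ⌈(2:ℝ) ^ k * x⌉ - 1 + 2 := by omega
  · exact mem_iUnion.2 ⟨0, by simpa using h⟩
  · exact mem_iUnion.2 ⟨1, by simpa using h⟩
  · exact mem_iUnion.2 ⟨2, by simpa using h⟩

/-- The image on the line of the Bernoulli measure restricted to controlled sequences. -/
noncomputable def controlledMeasure (s : ℝ) (M : ℕ) : Measure ℝ :=
  ((digitMeasure ht h1).restrict (controlledSet ξ q ((t - s) * Real.log 2) M)).map coding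

lemma controlledMeasure_le {s : ℝ} (hs : 0 < s) (hst : s < t) (M : ℕ) {U : Set ℝ} {k : ℕ}
    (hU : Metric.ediam U ≤ ENNReal.ofReal ((1 / 2 : ℝ) ^ k)) :
    controlledMeasure ht h1 s M U ≤
      ENNReal.ofReal (3 * (exp M * ∑' n, digitWeight ξ (t - s) q n)) *
        ENNReal.ofReal ((1 / 2 : ℝ) ^ k) ^ s := by
  obtain ⟨c, hc⟩ := exists_ceil_cover hU
  have hD : 0 ≤ ∑' n, digitWeight ξ (t - s) q n :=
    tsum_nonneg fun n => (digitWeight_pos ξ (t - s) q n).le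
  calc controlledMeasure ht h1 s M U
      ≤ ∑ i : Fin 3, controlledMeasure ht h1 s M {x : ℝ | ⌈(2:ℝ) ^ k * x⌉ = c + i} :=
        (measure_mono hc).trans (measure_iUnion_fintype_le _ _)
    _ ≤ ∑ _i : Fin 3, ENNReal.ofReal
          (exp M * (∑' n, digitWeight ξ (t - s) q n) * ((1 / 2 : ℝ) ^ k) ^ s) := by
        refine Finset.sum_le_sum fun i _ => ?_
        have hmeas : MeasurableSet {x : ℝ | ⌈(2:ℝ) ^ k * x⌉ = c + i} :=
          measurable_ceil_two_pow_mul k (MeasurableSet.singleton (c + (i : ℤ)))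
        rw [controlledMeasure, Measure.map_apply measurable_coding hmeas,
          Measure.restrict_apply (measurable_coding hmeas)]
        exact digitMeasure_dyadic_le ht h1 hs hst M k _
    _ = _ := by
        rw [Finset.sum_const, Finset.card_univ, Fintype.card_fin, nsmul_eq_mul,
          ENNReal.ofReal_rpow_of_nonneg (by positivity) hs.le,
          ← ENNReal.ofReal_mul (by positivity), ← ENNReal.ofReal_natCast,
          ← ENNReal.ofReal_mul (by positivity)]
        congr 1
        push_cast
        ring

lemma controlledMeasure_le_ediam {s : ℝ} (hs : 0 < s) (hst : s < t) (M : ℕ) {U : Set ℝ}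
    (hU : Metric.ediam U ≤ 1) :
    controlledMeasure ht h1 s M U ≤
      ENNReal.ofReal (3 * (exp M * ∑' n, digitWeight ξ (t - s) q n) * 2 ^ s) *
        Metric.ediam U ^ s := by
  have hD : 0 ≤ ∑' n, digitWeight ξ (t - s) q n :=
    tsum_nonneg fun n => (digitWeight_pos ξ (t - s) q n).le
  have htop : Metric.ediam U ≠ ⊤ := ne_top_of_le_ne_top ENNReal.one_ne_top hU
  rcases eq_or_ne (Metric.ediam U) 0 with h0 | h0
  · have hlim : Tendsto (fun k : ℕ =>
        ENNReal.ofReal (3 * (exp M * ∑' n, digitWeight ξ (t - s) q n)) *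
          ENNReal.ofReal ((1 / 2 : ℝ) ^ k) ^ s) atTop (nhds 0) := by
      have h2 : Tendsto (fun k : ℕ => ENNReal.ofReal ((1 / 2 : ℝ) ^ k)) atTop (nhds 0) := by
        have := (ENNReal.continuous_ofReal.tendsto 0).comp
          (tendsto_pow_atTop_nhds_zero_of_lt_one (by norm_num : (0:ℝ) ≤ 1 / 2) (by norm_num))
        rw [ENNReal.ofReal_zero] at this
        exact this
      have h3 := ENNReal.Tendsto.const_mul
        (a := ENNReal.ofReal (3 * (exp M * ∑' n, digitWeight ξ (t - s) q n)))
        (h2.ennrpow_const s) (Or.inr ENNReal.ofReal_ne_top)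
      rwa [ENNReal.zero_rpow_of_pos hs, mul_zero] at h3
    have := ge_of_tendsto' hlim fun k =>
      controlledMeasure_le ht h1 hs hst M (U := U) (k := k) (by simp [h0])
    exact this.trans zero_le
  · set d := (Metric.ediam U).toReal with hd
    have hUd : Metric.ediam U = ENNReal.ofReal d := (ENNReal.ofReal_toReal htop).symm
    have hd0 : 0 < d := ENNReal.toReal_pos h0 htop
    have hd1 : d ≤ 1 := ENNReal.toReal_le_of_le_ofReal zero_le_one (by simpa using hU)
    obtain ⟨k, hk, hk'⟩ := exists_nat_pow_near_of_lt_one hd0 hd1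
      (by norm_num : (0:ℝ) < 1 / 2) (by norm_num)
    refine (controlledMeasure_le ht h1 hs hst M (k := k)
      (hUd ▸ ENNReal.ofReal_le_ofReal hk')).trans ?_
    rw [hUd, ENNReal.ofReal_rpow_of_nonneg (by positivity) hs.le,
      ENNReal.ofReal_rpow_of_nonneg hd0.le hs.le, ← ENNReal.ofReal_mul (by positivity),
      ← ENNReal.ofReal_mul (by positivity)]
    refine ENNReal.ofReal_le_ofReal ?_
    rw [mul_assoc _ ((2:ℝ) ^ s), ← Real.mul_rpow (by norm_num) hd0.le]
    gcongr
    rw [pow_succ] at hk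
    linarith

end LowerBound

lemma le_dimH_coding_image {ξ t q : ℝ} (ht : 0 < t)
    (h1 : ∑' n, digitWeight ξ t q n = 1)
    (h0 : ∑' n : ℕ+, digitWeight ξ t q n * (Real.log ((n : ℕ) : ℝ) - ξ) = 0) {s : ℝ}
    (hs : 0 < s) (hst : s < t) :
    ENNReal.ofReal s ≤ dimH (coding '' logAverageSet ξ) := by
  have hae := ae_mem_logAverageSet ht h1 h0
  have hε : 0 < (t - s) * Real.log 2 :=
    mul_pos (sub_pos.2 hst) (Real.log_pos (by norm_num))
  obtain ⟨M, hM⟩ : ∃ M : ℕ, digitMeasure ht h1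
      (logAverageSet ξ ∩ controlledSet ξ q ((t - s) * Real.log 2) M) ≠ 0 := by
    by_contra! h
    have h2 : digitMeasure ht h1 (logAverageSet ξ) = 0 := by
      refine measure_mono_null (fun ω hω => ?_) (measure_iUnion_null h)
      obtain ⟨M, hωM⟩ :=
        mem_iUnion.1 (logAverageSet_subset_iUnion_controlledSet ξ q hε hω)
      exact mem_iUnion.2 ⟨M, hω, hωM⟩
    rw [measure_congr (eventuallyEq_univ.2 hae), measure_univ] at h2
    exact one_ne_zero h2
  have hpos : controlledMeasure ht h1 s M (coding '' logAverageSet ξ) ≠ 0 := by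
    refine fun h => hM (le_antisymm ?_ zero_le)
    rw [← h, ← Measure.restrict_apply' (measurableSet_controlledSet ξ q _ M)]
    exact (measure_mono (subset_preimage_image _ _)).trans
      (Measure.le_map_apply measurable_coding.aemeasurable _)
  set C : ENNReal :=
    ENNReal.ofReal (3 * (exp M * ∑' n, digitWeight ξ (t - s) q n) * 2 ^ s) with hC
  have hC0 : C ≠ 0 := by
    have := (summable_digitWeight ξ (sub_pos.2 hst) q).tsum_pos
      (fun n => (digitWeight_pos ξ (t - s) q n).le) 1 (digitWeight_pos ξ (t - s) q 1)
    rw [hC, Ne, ENNReal.ofReal_eq_zero, not_le]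
    positivity
  have hCt : C ≠ ⊤ := ENNReal.ofReal_ne_top
  have hle : C⁻¹ • controlledMeasure ht h1 s M ≤ Measure.hausdorffMeasure s := by
    refine Measure.le_hausdorffMeasure s _ 1 one_pos fun U hU => ?_
    rw [Measure.smul_apply, smul_eq_mul, mul_comm, ← div_eq_mul_inv]
    refine ENNReal.div_le_of_le_mul ?_
    rw [mul_comm]
    exact controlledMeasure_le_ediam ht h1 hs hst M hU
  have hne : Measure.hausdorffMeasure ((s.toNNReal : NNReal) : ℝ)
      (coding '' logAverageSet ξ) ≠ 0 := by
    rw [Real.coe_toNNReal s hs.le]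
    refine fun h => hpos ?_
    have h2 := hle (coding '' logAverageSet ξ)
    rw [h, Measure.smul_apply, smul_eq_mul, nonpos_iff_eq_zero, mul_eq_zero] at h2
    exact h2.resolve_left (ENNReal.inv_ne_zero.2 hCt)
  exact le_dimH_of_hausdorffMeasure_ne_zero hne

lemma dimH_coding_image {ξ t q : ℝ} (ht : 0 < t)
    (h1 : ∑' n, digitWeight ξ t q n = 1)
    (h0 : ∑' n : ℕ+, digitWeight ξ t q n * (Real.log ((n : ℕ) : ℝ) - ξ) = 0) :
    dimH (coding '' logAverageSet ξ) = ENNReal.ofReal t := by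
  refine le_antisymm (dimH_coding_image_le ht h1) ?_
  have hlim : Tendsto ENNReal.ofReal (nhdsWithin t (Iio t)) (nhds (ENNReal.ofReal t)) :=
    (ENNReal.continuous_ofReal.tendsto t).mono_left nhdsWithin_le_nhds
  refine le_of_tendsto hlim ?_
  filter_upwards [self_mem_nhdsWithin, nhdsWithin_le_nhds (lt_mem_nhds ht)] with s hst hs
  exact le_dimH_coding_image ht h1 h0 hs hst

theorem birkhoff_spectrum_log_digit (ξ : ℝ) (hξ : 0 < ξ) :
    ∃ t q : ℝ,
      (0 ≤ t ∧ t ≤ 1 ∧ (0 < t ∨ q < -1) ∧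
        Real.log (∑' n : ℕ+, (2:ℝ) ^ (-((n : ℕ) : ℝ) * t) * ((n : ℕ) : ℝ) ^ q) = q * ξ ∧
        (∑' n : ℕ+, (2:ℝ) ^ (-((n : ℕ) : ℝ) * t) * Real.log ((n : ℕ) : ℝ) * ((n : ℕ) : ℝ) ^ q) /
          (∑' n : ℕ+, (2:ℝ) ^ (-((n : ℕ) : ℝ) * t) * ((n : ℕ) : ℝ) ^ q) = ξ) ∧
      (∀ t' q' : ℝ,
        0 ≤ t' → t' ≤ 1 → (0 < t' ∨ q' < -1) →
        Real.log (∑' n : ℕ+, (2:ℝ) ^ (-((n : ℕ) : ℝ) * t') * ((n : ℕ) : ℝ) ^ q') = q' * ξ →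
        (∑' n : ℕ+, (2:ℝ) ^ (-((n : ℕ) : ℝ) * t') * Real.log ((n : ℕ) : ℝ) * ((n : ℕ) : ℝ) ^ q') /
          (∑' n : ℕ+, (2:ℝ) ^ (-((n : ℕ) : ℝ) * t') * ((n : ℕ) : ℝ) ^ q') = ξ →
        t' = t ∧ q' = q) ∧
      dimH (logDigitLevelSet ξ) = ENNReal.ofReal t := by
  obtain ⟨t, q, ht, ht1, h1, h0⟩ := solution_exists hξ
  have he := (equations_iff ξ ht q).2 ⟨h1, h0⟩
  refine ⟨t, q, ⟨ht.le, ht1, Or.inl ht, he.1, he.2⟩, fun t' q' ht0' _ hor hlog hratio => ?_, ?_⟩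
  · have ht' : 0 < t' := by
      refine ht0'.lt_of_ne fun h => ?_
      subst h
      have hq : q' < -1 := hor.resolve_left (lt_irrefl 0)
      have hs : Summable fun n : ℕ+ => (2:ℝ) ^ (-((n : ℕ) : ℝ) * 0) * ((n : ℕ) : ℝ) ^ q' := by
        simpa [Function.comp_def] using
          (Real.summable_nat_rpow.2 hq).comp_injective PNat.coe_injective
      have hle := hs.le_tsum 1 fun n _ => by positivity
      have hlog0 := Real.log_nonneg (le_trans (by simp) hle)
      rw [hlog] at hlog0
      nlinarith
    obtain ⟨h1', h0'⟩ := (equations_iff ξ ht' q').1 ⟨hlog, hratio⟩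
    exact solution_unique hξ ht ht' h1 h0 h1' h0'
  · rw [logDigitLevelSet_eq_image hξ.ne', dimH_coding_image ht h1 h0]
end

section
/- The Hausdorff dimension of the set {x ∈ (0,1] : lim_{m→∞} (1/m) ∑_{j=1}^{m} log(d_j(x)) = 0} is 0. -/
open MeasureTheory Filter Real Set

/-- The branch of `p2gleT` containing the `j`-th iterate of `x`, counted from zero. -/
noncomputable def p2gleBranch (j : ℕ) (x : ℝ) : ℕ := ⌊-Real.logb 2 (p2gleT^[j] x)⌋.toNat

/-- Points all of whose branch indices have logarithmic averages at most `ε` from time `N` on. -/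
noncomputable def smallLogBranchSet (ε : ℝ) (N : ℕ) : Set ℝ :=
  {x ∈ Ioc (0:ℝ) 1 |
    ∀ m : ℕ, N ≤ m → ∑ j ∈ Finset.range m, Real.log ((p2gleBranch j x : ℝ) + 1) ≤ ε * m}

lemma floor_neg_logb_nonneg {x : ℝ} (hx : x ∈ Ioc (0:ℝ) 1) : 0 ≤ ⌊-Real.logb 2 x⌋ :=
  Int.floor_nonneg.2 (neg_nonneg.2 (Real.logb_nonpos (by norm_num) hx.1.le hx.2))

lemma p2gleT_mem {x : ℝ} (hx : x ∈ Ioc (0:ℝ) 1) : p2gleT x ∈ Ioc (0:ℝ) 1 := by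
  have hlog : (2:ℝ) ^ Real.logb 2 x = x :=
    Real.rpow_logb (by norm_num) (by norm_num) hx.1
  have key : (2:ℝ) ^ (⌊-Real.logb 2 x⌋ + 1) * x
      = (2:ℝ) ^ (((⌊-Real.logb 2 x⌋ : ℝ) + 1) + Real.logb 2 x) := by
    rw [Real.rpow_add (by norm_num), hlog, ← Real.rpow_intCast]
    push_cast
    rfl
  have h1 := Int.floor_le (-Real.logb 2 x)
  have h2 := Int.lt_floor_add_one (-Real.logb 2 x)
  unfold p2gleT
  rw [key]
  constructor
  · have := Real.one_lt_rpow (x := 2) (by norm_num)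
      (show 0 < ((⌊-Real.logb 2 x⌋ : ℝ) + 1) + Real.logb 2 x by linarith)
    linarith
  · have := Real.rpow_le_rpow_of_exponent_le (x := 2) (by norm_num)
      (show ((⌊-Real.logb 2 x⌋ : ℝ) + 1) + Real.logb 2 x ≤ 1 by linarith)
    rw [Real.rpow_one] at this
    linarith

lemma p2gleT_iterate_mem {x : ℝ} (hx : x ∈ Ioc (0:ℝ) 1) (j : ℕ) :
    p2gleT^[j] x ∈ Ioc (0:ℝ) 1 := by
  induction j with
  | zero => exact hx
  | succ j ih => rw [Function.iterate_succ_apply']; exact p2gleT_mem ih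

lemma p2gleT_iterate_succ {x : ℝ} (hx : x ∈ Ioc (0:ℝ) 1) (j : ℕ) :
    p2gleT^[j + 1] x = 2 ^ (p2gleBranch j x + 1) * p2gleT^[j] x - 1 := by
  have h : ((p2gleBranch j x : ℕ) : ℤ) = ⌊-Real.logb 2 (p2gleT^[j] x)⌋ :=
    Int.toNat_of_nonneg (floor_neg_logb_nonneg (p2gleT_iterate_mem hx j))
  rw [Function.iterate_succ_apply', p2gleT, ← h, ← zpow_natCast]
  push_cast
  rfl

lemma p2gleT_iterate_sub {x y : ℝ} (hx : x ∈ Ioc (0:ℝ) 1) (hy : y ∈ Ioc (0:ℝ) 1) (m : ℕ)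
    (h : ∀ j < m, p2gleBranch j x = p2gleBranch j y) :
    p2gleT^[m] x - p2gleT^[m] y
      = (∏ j ∈ Finset.range m, (2:ℝ) ^ (p2gleBranch j y + 1)) * (x - y) := by
  induction m with
  | zero => simp
  | succ m ih =>
    rw [p2gleT_iterate_succ hx, p2gleT_iterate_succ hy, Finset.prod_range_succ, h m (by omega)]
    linear_combination (2:ℝ) ^ (p2gleBranch m y + 1) * ih fun j hj => h j (by omega)

lemma abs_sub_le_of_p2gleBranch_eq {x y : ℝ} (hx : x ∈ Ioc (0:ℝ) 1) (hy : y ∈ Ioc (0:ℝ) 1)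
    (m : ℕ) (w : Fin m → ℕ) (hxw : ∀ j : Fin m, p2gleBranch j x = w j)
    (hyw : ∀ j : Fin m, p2gleBranch j y = w j) :
    |x - y| ≤ ∏ j, (1 / 2 : ℝ) ^ (w j + 1) := by
  have h := p2gleT_iterate_sub hx hy m fun j hj => (hxw ⟨j, hj⟩).trans (hyw ⟨j, hj⟩).symm
  have hp : ∏ j ∈ Finset.range m, (2:ℝ) ^ (p2gleBranch j y + 1) = ∏ j, (2:ℝ) ^ (w j + 1) := by
    rw [Finset.prod_range]
    exact Finset.prod_congr rfl fun j _ => by rw [hyw j]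
  have hle : |p2gleT^[m] x - p2gleT^[m] y| ≤ 1 := by
    have h1 := p2gleT_iterate_mem hx m
    have h2 := p2gleT_iterate_mem hy m
    rw [abs_le]
    constructor <;> linarith [h1.1, h1.2, h2.1, h2.2]
  have hpos : 0 < ∏ j, (2:ℝ) ^ (w j + 1) := Finset.prod_pos fun _ _ => by positivity
  rw [h, hp, abs_mul, abs_of_pos hpos] at hle
  have hinv : ∏ j, (1 / 2 : ℝ) ^ (w j + 1) = (∏ j, (2:ℝ) ^ (w j + 1))⁻¹ := by
    rw [← Finset.prod_inv_distrib]
    exact Finset.prod_congr rfl fun j _ => by rw [one_div, inv_pow]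
  rw [hinv, ← one_div, le_div_iff₀ hpos]
  linarith

lemma p2gleT_iterate_one (j : ℕ) : p2gleT^[j] 1 = 1 :=
  Function.iterate_fixed p2gleT_one j

lemma p2gleBranch_eq_zero {x : ℝ} {i j : ℕ} (h : p2gleT^[i] x = 1) (hij : i ≤ j) :
    p2gleBranch j x = 0 := by
  obtain ⟨k, rfl⟩ := Nat.exists_eq_add_of_le hij
  rw [p2gleBranch, add_comm, Function.iterate_add_apply, h, p2gleT_iterate_one]
  simp

/-- The digits agree with the branch indices unless the orbit reaches the fixed point `1`. -/
lemma p2gleD_eq_or_iterate_eq_one {x : ℝ} (hx : x ∈ Ioc (0:ℝ) 1) (j : ℕ) :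
    p2gleD j x = p2gleBranch j x + 1 ∨ p2gleT^[j + 1] x = 1 := by
  have hmem := p2gleT_iterate_mem hx j
  have h : ((p2gleBranch j x : ℕ) : ℤ) = ⌊-Real.logb 2 (p2gleT^[j] x)⌋ :=
    Int.toNat_of_nonneg (floor_neg_logb_nonneg hmem)
  by_cases hr : -Real.logb 2 (p2gleT^[j] x) ∈ Set.range (Int.cast : ℤ → ℝ)
  · right
    obtain ⟨n, hn⟩ := hr
    rw [← hn, Int.floor_intCast] at h
    have hb : Real.logb 2 (p2gleT^[j] x) = -(p2gleBranch j x : ℝ) := by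
      have : ((p2gleBranch j x : ℕ) : ℝ) = (n : ℝ) := by exact_mod_cast h
      linarith
    have hval : p2gleT^[j] x = ((2:ℝ) ^ p2gleBranch j x)⁻¹ := by
      rw [← Real.rpow_natCast, ← Real.rpow_neg (by norm_num), ← hb,
        Real.rpow_logb (by norm_num) (by norm_num) hmem.1]
    rw [p2gleT_iterate_succ hx, hval, pow_succ]
    field_simp
    norm_num
  · left
    rw [p2gleD, (Int.ceil_eq_floor_add_one_iff_notMem _).2 hr, h]

lemma logDigitLevelSet_zero_subset {ε : ℝ} (hε : 0 < ε) :
    logDigitLevelSet 0 ⊆ ⋃ N, smallLogBranchSet ε N := by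
  rintro x ⟨hx, hlim⟩
  suffices h : Tendsto (fun m : ℕ =>
      (∑ j ∈ Finset.range m, Real.log ((p2gleBranch j x : ℝ) + 1)) / m) atTop (nhds 0) by
    obtain ⟨N, hN⟩ := eventually_atTop.1 ((h.eventually (gt_mem_nhds hε)).and
      (eventually_gt_atTop 0))
    refine mem_iUnion.2 ⟨N, hx, fun m hm => ?_⟩
    obtain ⟨h1, h2⟩ := hN m hm
    exact ((div_lt_iff₀ (by exact_mod_cast h2)).1 h1).le
  by_cases hd : ∀ j, p2gleD j x = p2gleBranch j x + 1
  · refine hlim.congr fun m => ?_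
    congr 1
    refine Finset.sum_congr rfl fun j _ => ?_
    rw [hd j]
    push_cast
    rfl
  · push Not at hd
    obtain ⟨i, hi⟩ := hd
    have h1 := (p2gleD_eq_or_iterate_eq_one hx i).resolve_left hi
    refine (tendsto_const_div_atTop_nhds_zero_nat
      (∑ j ∈ Finset.range (i + 1), Real.log ((p2gleBranch j x : ℝ) + 1))).congr' ?_
    filter_upwards [eventually_ge_atTop (i + 1)] with m hm
    congr 1
    refine Finset.sum_subset (Finset.range_mono hm) fun j _ hj => ?_
    rw [p2gleBranch_eq_zero h1 (by simpa using hj)]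
    simp

lemma ENNReal.tsum_pi_fin_prod (g : ℕ → ENNReal) (m : ℕ) :
    ∑' w : Fin m → ℕ, ∏ j, g (w j) = (∑' k, g k) ^ m := by
  induction m with
  | zero => simp
  | succ m ih =>
    rw [← (Fin.consEquiv fun _ : Fin (m + 1) => ℕ).tsum_eq]
    simp only [Fin.consEquiv_apply, Fin.prod_univ_succ, Fin.cons_zero, Fin.cons_succ]
    rw [ENNReal.tsum_prod (f := fun a (b : Fin m → ℕ) => g a * ∏ j, g (b j))]
    simp only [ENNReal.tsum_mul_left, ih, ENNReal.tsum_mul_right]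
    rw [pow_succ']

lemma exists_tsum_weighted_geometric_lt_one {a : ℝ} (ha0 : 0 < a) (ha1 : a < 1) :
    ∃ t : ℕ, ∑' k : ℕ, ENNReal.ofReal (a ^ (k + 1) * (((k : ℝ) + 1) ^ t)⁻¹) < 1 := by
  have hbound (t : ℕ) : ∑' k : ℕ, ENNReal.ofReal (a ^ (k + 1) * (((k : ℝ) + 1) ^ t)⁻¹)
      ≤ ENNReal.ofReal (a + (1 / 2) ^ t * (1 - a)⁻¹) := by
    have hs : Summable fun k : ℕ => a ^ k := summable_geometric_of_lt_one ha0.le ha1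
    rw [tsum_eq_zero_add' ENNReal.summable, ENNReal.ofReal_add ha0.le
      (mul_nonneg (by positivity) (inv_nonneg.2 (by linarith)))]
    refine add_le_add (by simp) ?_
    rw [← tsum_geometric_of_lt_one ha0.le ha1, ← tsum_mul_left,
      ENNReal.ofReal_tsum_of_nonneg (fun k => by positivity) (hs.mul_left _)]
    refine ENNReal.tsum_le_tsum fun k => ENNReal.ofReal_le_ofReal ?_
    rw [mul_comm]
    refine mul_le_mul ?_ (pow_le_pow_of_le_one ha0.le ha1.le (by omega)) (by positivity)
      (by positivity)
    rw [one_div, inv_pow]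
    refine inv_anti₀ (by positivity) (pow_le_pow_left₀ (by norm_num) ?_ t)
    push_cast
    linarith [(Nat.cast_nonneg k : (0:ℝ) ≤ k)]
  have hlim : Tendsto (fun t : ℕ => a + (1 / 2 : ℝ) ^ t * (1 - a)⁻¹) atTop (nhds a) := by
    simpa using ((tendsto_pow_atTop_nhds_zero_of_lt_one (r := (1 / 2 : ℝ)) (by norm_num)
      (by norm_num)).mul_const (1 - a)⁻¹).const_add a
  obtain ⟨t, ht⟩ := (hlim.eventually (gt_mem_nhds ha1)).exists
  exact ⟨t, (hbound t).trans_lt (ENNReal.ofReal_lt_one.2 ht)⟩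

lemma exists_exp_mul_lt_one {c : ENNReal} (hc : c < 1) (t : ℝ) :
    ∃ ε > 0, ENNReal.ofReal (Real.exp (t * ε)) * c < 1 := by
  have hlim : Tendsto (fun ε : ℝ => Real.exp (t * ε) * c.toReal) (nhdsWithin 0 (Ioi 0))
      (nhds c.toReal) := by
    have : Continuous fun ε : ℝ => Real.exp (t * ε) * c.toReal := by fun_prop
    simpa using (this.tendsto 0).mono_left nhdsWithin_le_nhds
  have hc' : c.toReal < 1 := ENNReal.toReal_lt_of_lt_ofReal (by simpa using hc)
  obtain ⟨ε, h1, h2⟩ := ((hlim.eventually (gt_mem_nhds hc')).and self_mem_nhdsWithin).exists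
  refine ⟨ε, h2, ?_⟩
  rw [← ENNReal.ofReal_toReal hc.ne_top, ← ENNReal.ofReal_mul (Real.exp_pos _).le]
  exact ENNReal.ofReal_lt_one.2 h1

lemma prod_pow_le_exp {m : ℕ} (w : Fin m → ℕ) (t : ℕ) {ε : ℝ}
    (h : ∑ j, Real.log ((w j : ℝ) + 1) ≤ ε * m) :
    ∏ j, ((w j : ℝ) + 1) ^ t ≤ Real.exp (t * ε) ^ m := by
  have hprod : ∏ j, ((w j : ℝ) + 1) ^ t = Real.exp (t * ∑ j, Real.log ((w j : ℝ) + 1)) := by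
    rw [Finset.mul_sum, Real.exp_sum]
    refine Finset.prod_congr rfl fun j _ => ?_
    rw [mul_comm, Real.exp_mul, Real.exp_log (by positivity), Real.rpow_natCast]
  rw [hprod, ← Real.exp_nat_mul]
  refine Real.exp_le_exp.2 ?_
  calc (t : ℝ) * ∑ j, Real.log ((w j : ℝ) + 1) ≤ t * (ε * m) := by gcongr
    _ = m * (t * ε) := by ring

lemma exists_hausdorffMeasure_smallLogBranchSet_eq_zero {s : ℝ} (hs : 0 < s) :
    ∃ ε > 0, ∀ N, μH[s] (smallLogBranchSet ε N) = 0 := by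
  set a : ℝ := (1 / 2) ^ s with ha
  have ha0 : 0 < a := by positivity
  have ha1 : a < 1 := Real.rpow_lt_one (by norm_num) (by norm_num) hs
  obtain ⟨t, ht⟩ := exists_tsum_weighted_geometric_lt_one ha0 ha1
  obtain ⟨ε, hε, hlt⟩ := exists_exp_mul_lt_one ht t
  refine ⟨ε, hε, fun N => ?_⟩
  set f : ℕ → ℝ := fun k => a ^ (k + 1) * (((k : ℝ) + 1) ^ t)⁻¹ with hf
  have hf0 (k : ℕ) : 0 ≤ f k := by positivity
  set q := ENNReal.ofReal (Real.exp (t * ε)) * ∑' k, ENNReal.ofReal (f k) with hq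
  let U : ∀ m : ℕ, (Fin m → ℕ) → Set ℝ := fun m w =>
    {x ∈ smallLogBranchSet ε N | ∀ j : Fin m, p2gleBranch j x = w j}
  have hdiam (m : ℕ) (w : Fin m → ℕ) :
      Metric.ediam (U m w) ≤ ENNReal.ofReal (∏ j, (1 / 2 : ℝ) ^ (w j + 1)) := by
    refine Metric.ediam_le fun x hx y hy => ?_
    rw [edist_dist, Real.dist_eq]
    exact ENNReal.ofReal_le_ofReal
      (abs_sub_le_of_p2gleBranch_eq hx.1.1 hy.1.1 m w hx.2 hy.2)
  have hweight (m : ℕ) (hm : N ≤ m) (w : Fin m → ℕ) : Metric.ediam (U m w) ^ s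
      ≤ ENNReal.ofReal (Real.exp (t * ε)) ^ m * ∏ j, ENNReal.ofReal (f (w j)) := by
    rcases (U m w).eq_empty_or_nonempty with he | ⟨x, hx⟩
    · simp [he, hs]
    have hsum : ∑ j, Real.log ((w j : ℝ) + 1) ≤ ε * m := by
      have := hx.1.2 m hm
      rw [Finset.sum_range] at this
      simpa only [hx.2] using this
    have hexp := prod_pow_le_exp w t hsum
    rw [← ENNReal.ofReal_prod_of_nonneg fun j _ => hf0 _,
      ← ENNReal.ofReal_pow (Real.exp_pos _).le, ← ENNReal.ofReal_mul (by positivity)]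
    refine (ENNReal.rpow_le_rpow (hdiam m w) hs.le).trans ?_
    rw [ENNReal.ofReal_rpow_of_nonneg (Finset.prod_nonneg fun _ _ => by positivity) hs.le]
    refine ENNReal.ofReal_le_ofReal ?_
    have hpow : (∏ j, (1 / 2 : ℝ) ^ (w j + 1)) ^ s = ∏ j, a ^ (w j + 1) := by
      rw [← Real.finsetProd_rpow _ _ fun _ _ => by positivity]
      refine Finset.prod_congr rfl fun j _ => ?_
      rw [ha, ← Real.rpow_natCast, ← Real.rpow_natCast, ← Real.rpow_mul (by norm_num), mul_comm,
        Real.rpow_mul (by norm_num)]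
    have hpos : 0 < ∏ j, ((w j : ℝ) + 1) ^ t := Finset.prod_pos fun _ _ => by positivity
    have hfprod : ∏ j, f (w j) = (∏ j, a ^ (w j + 1)) * (∏ j, ((w j : ℝ) + 1) ^ t)⁻¹ := by
      rw [← Finset.prod_inv_distrib, ← Finset.prod_mul_distrib]
    have hapos : 0 ≤ ∏ j, a ^ (w j + 1) := Finset.prod_nonneg fun _ _ => by positivity
    rw [hpow, hfprod, mul_left_comm, ← div_eq_mul_inv]
    exact le_mul_of_one_le_right hapos ((one_le_div hpos).2 hexp)
  have hmesh (m : ℕ) (w : Fin m → ℕ) :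
      Metric.ediam (U m w) ≤ ENNReal.ofReal ((1 / 2 : ℝ) ^ m) := by
    refine (hdiam m w).trans (ENNReal.ofReal_le_ofReal ?_)
    calc ∏ j, (1 / 2 : ℝ) ^ (w j + 1) ≤ ∏ _j : Fin m, (1 / 2 : ℝ) :=
          Finset.prod_le_prod (fun _ _ => by positivity) fun j _ =>
            pow_le_of_le_one (by norm_num) (by norm_num) (Nat.succ_ne_zero _)
      _ = (1 / 2 : ℝ) ^ m := by simp
  have hr : Tendsto (fun m : ℕ => ENNReal.ofReal ((1 / 2 : ℝ) ^ m)) atTop (nhds 0) := by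
    simpa using ENNReal.tendsto_ofReal (tendsto_pow_atTop_nhds_zero_of_lt_one
      (r := (1 / 2 : ℝ)) (by norm_num) (by norm_num))
  have hliminf := Measure.hausdorffMeasure_le_liminf_tsum s (smallLogBranchSet ε N) _ hr U
    (Eventually.of_forall hmesh)
    (Eventually.of_forall fun m x hx =>
      mem_iUnion.2 ⟨fun j : Fin m => p2gleBranch j x, hx, fun _ => rfl⟩)
  have htend : Tendsto (fun m => ∑' w, Metric.ediam (U m w) ^ s) atTop (nhds 0) := by
    refine tendsto_of_tendsto_of_tendsto_of_le_of_le' tendsto_const_nhds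
      (ENNReal.tendsto_pow_atTop_nhds_zero_of_lt_one hlt)
      (Eventually.of_forall fun _ => zero_le) ?_
    filter_upwards [eventually_ge_atTop N] with m hm
    refine (ENNReal.tsum_le_tsum (hweight m hm)).trans_eq ?_
    rw [ENNReal.tsum_mul_left, ENNReal.tsum_pi_fin_prod fun k => ENNReal.ofReal (f k), ← mul_pow]
  exact le_antisymm (hliminf.trans_eq htend.liminf_eq) zero_le

theorem dimH_logDigit_zero : dimH (logDigitLevelSet 0) = 0 := by
  refine le_antisymm (ENNReal.le_of_forall_pos_le_add fun s hs _ => ?_) zero_le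
  rw [zero_add]
  obtain ⟨ε, hε, h⟩ := exists_hausdorffMeasure_smallLogBranchSet_eq_zero
    (s := (s : ℝ)) (by exact_mod_cast hs)
  refine (dimH_mono (logDigitLevelSet_zero_subset hε)).trans ?_
  rw [dimH_iUnion]
  exact iSup_le fun N => dimH_le_of_hausdorffMeasure_ne_top (by rw [h N]; exact ENNReal.zero_ne_top)
end

section
/- Fix t ≥ 0. For every q < 0 the ratio ( ∑_{n=1}^{∞} 2^{−n(t−1)} e^{2^{n} q} ) / ( ∑_{n=1}^{∞} 2^{−n t} e^{2^{n} q} ) is strictly greater than 2, and this ratio tends to 2 as q → −∞. -/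
open Filter Real

/-- A quadratic bound on the decay of the exponential at `-∞`. -/
lemma exp_mul_sq_le_two {x : ℝ} (hx : x ≤ 0) : Real.exp x * x ^ 2 ≤ 2 := by
  have h := Real.pow_div_factorial_le_exp (-x) (by linarith) 2
  have h2 : x ^ 2 ≤ 2 * Real.exp (-x) := by
    norm_num [Nat.factorial] at h
    linarith
  calc Real.exp x * x ^ 2 ≤ Real.exp x * (2 * Real.exp (-x)) := by gcongr
    _ = 2 := by rw [Real.exp_neg]; field_simp

lemma two_rpow_neg_mul_sub_one (t : ℝ) (n : ℕ) :
    (2:ℝ) ^ (-(n : ℝ) * (t - 1)) = 2 ^ n * (2:ℝ) ^ (-(n : ℝ) * t) := by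
  rw [← Real.rpow_natCast, ← Real.rpow_add two_pos]
  ring_nf

lemma hasSum_pnat_half_pow : HasSum (fun n : ℕ+ => ((1:ℝ) / 2) ^ (n : ℕ)) 1 := by
  rw [hasSum_pnat_iff_hasSum_succ (f := fun n : ℕ => ((1:ℝ) / 2) ^ n)]
  simpa [pow_succ, div_eq_mul_inv] using hasSum_geometric_two.mul_right ((1:ℝ) / 2)

lemma two_pow_mul_exp_le {q : ℝ} (hq : q < 0) (n : ℕ) :
    (2:ℝ) ^ n * Real.exp ((2:ℝ) ^ n * q) ≤ 2 / q ^ 2 * (1 / 2) ^ n := by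
  have h := exp_mul_sq_le_two (x := (2:ℝ) ^ n * q)
    (mul_nonpos_of_nonneg_of_nonpos (by positivity) hq.le)
  have hq2 : 0 < q ^ 2 := sq_pos_of_neg hq
  rw [one_div, inv_pow, ← div_eq_mul_inv, div_div, le_div_iff₀ (by positivity)]
  linarith

lemma summable_two_pow_mul_digit_term {t q : ℝ} (ht : 0 ≤ t) (hq : q < 0) :
    Summable (fun n : ℕ+ => (2:ℝ) ^ (n : ℕ) *
      ((2:ℝ) ^ (-((n : ℕ) : ℝ) * t) * Real.exp ((2:ℝ) ^ (n : ℕ) * q))) := by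
  refine Summable.of_nonneg_of_le (fun n => by positivity) (fun n => ?_)
    (hasSum_pnat_half_pow.summable.mul_left (2 / q ^ 2))
  refine le_trans ?_ (two_pow_mul_exp_le hq n)
  gcongr
  refine mul_le_of_le_one_left (by positivity) (Real.rpow_le_one_of_one_le_of_nonpos one_le_two ?_)
  exact mul_nonpos_of_nonpos_of_nonneg (by simp) ht

lemma summable_digit_term {t q : ℝ} (ht : 0 ≤ t) (hq : q < 0) :
    Summable (fun n : ℕ+ =>
      (2:ℝ) ^ (-((n : ℕ) : ℝ) * t) * Real.exp ((2:ℝ) ^ (n : ℕ) * q)) :=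
  Summable.of_nonneg_of_le (fun n => by positivity)
    (fun n => le_mul_of_one_le_left (by positivity) (one_le_pow₀ one_le_two))
    (summable_two_pow_mul_digit_term ht hq)

/-- Each term of the excess `∑ (2 ^ n - 2) aₙ` is controlled by the first term `a₁`. -/
lemma two_pow_sub_two_mul_digit_term_le {t q : ℝ} (ht : 0 ≤ t) (hq : q < 0) (n : ℕ+) :
    ((2:ℝ) ^ (n : ℕ) - 2) * ((2:ℝ) ^ (-((n : ℕ) : ℝ) * t) * Real.exp ((2:ℝ) ^ (n : ℕ) * q)) ≤
      (2:ℝ) ^ (-t) * Real.exp (2 * q) * (8 / q ^ 2) * (1 / 2) ^ (n : ℕ) := by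
  obtain ⟨m, hm⟩ : ∃ m, (n : ℕ) = m + 1 := ⟨n - 1, by have := n.pos; omega⟩
  rw [hm]
  rcases Nat.eq_zero_or_pos m with rfl | hpos
  · norm_num
    positivity
  have h2 : (2:ℝ) ≤ 2 ^ m := by simpa using pow_le_pow_right₀ (one_le_two (α := ℝ)) hpos
  have hexp : Real.exp ((2:ℝ) ^ (m + 1) * q) ≤ Real.exp (2 * q) * Real.exp ((2:ℝ) ^ m * q) := by
    rw [← Real.exp_add, Real.exp_le_exp, pow_succ]
    nlinarith
  have hrpow : (2:ℝ) ^ (-((m + 1 : ℕ) : ℝ) * t) ≤ (2:ℝ) ^ (-t) := by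
    apply Real.rpow_le_rpow_of_exponent_le one_le_two
    push_cast
    nlinarith [mul_nonneg (Nat.cast_nonneg (α := ℝ) m) ht]
  calc ((2:ℝ) ^ (m + 1) - 2) *
        ((2:ℝ) ^ (-((m + 1 : ℕ) : ℝ) * t) * Real.exp ((2:ℝ) ^ (m + 1) * q))
      ≤ (2 * 2 ^ m) * ((2:ℝ) ^ (-t) * (Real.exp (2 * q) * Real.exp ((2:ℝ) ^ m * q))) := by
        gcongr
        rw [pow_succ]
        linarith
    _ = (2:ℝ) ^ (-t) * Real.exp (2 * q) * 2 * (2 ^ m * Real.exp ((2:ℝ) ^ m * q)) := by ring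
    _ ≤ (2:ℝ) ^ (-t) * Real.exp (2 * q) * 2 * (2 / q ^ 2 * (1 / 2) ^ m) := by
        exact mul_le_mul_of_nonneg_left (two_pow_mul_exp_le hq m) (by positivity)
    _ = (2:ℝ) ^ (-t) * Real.exp (2 * q) * (8 / q ^ 2) * (1 / 2) ^ (m + 1) := by ring

lemma digit_ratio_bounds {t q : ℝ} (ht : 0 ≤ t) (hq : q < 0) :
    2 < (∑' n : ℕ+, (2:ℝ) ^ (-((n : ℕ) : ℝ) * (t - 1)) * Real.exp ((2:ℝ) ^ (n : ℕ) * q)) /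
        (∑' n : ℕ+, (2:ℝ) ^ (-((n : ℕ) : ℝ) * t) * Real.exp ((2:ℝ) ^ (n : ℕ) * q)) ∧
    (∑' n : ℕ+, (2:ℝ) ^ (-((n : ℕ) : ℝ) * (t - 1)) * Real.exp ((2:ℝ) ^ (n : ℕ) * q)) /
        (∑' n : ℕ+, (2:ℝ) ^ (-((n : ℕ) : ℝ) * t) * Real.exp ((2:ℝ) ^ (n : ℕ) * q)) ≤
      2 + 8 / q ^ 2 := by
  simp_rw [two_rpow_neg_mul_sub_one, mul_assoc]
  have hle := two_pow_sub_two_mul_digit_term_le ht hq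
  have hN := summable_two_pow_mul_digit_term ht hq
  have hD := summable_digit_term ht hq
  set a : ℕ+ → ℝ := fun n =>
    (2:ℝ) ^ (-((n : ℕ) : ℝ) * t) * Real.exp ((2:ℝ) ^ (n : ℕ) * q) with ha
  have hapos : ∀ n, 0 < a n := fun n => by simp only [ha]; positivity
  have hfirst : (2:ℝ) ^ (-t) * Real.exp (2 * q) ≤ ∑' n, a n := by
    have h := hD.le_tsum 1 (fun n _ => (hapos n).le)
    simpa [ha] using h
  have hDpos : 0 < ∑' n, a n := lt_of_lt_of_le (by positivity) hfirst
  have hsub : Summable (fun n : ℕ+ => ((2:ℝ) ^ (n : ℕ) - 2) * a n) := by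
    simpa only [sub_mul] using hN.sub (hD.mul_left 2)
  have hexcess : ∑' n : ℕ+, ((2:ℝ) ^ (n : ℕ) - 2) * a n =
      ∑' n : ℕ+, (2:ℝ) ^ (n : ℕ) * a n - 2 * ∑' n, a n := by
    simp only [sub_mul]
    rw [hN.tsum_sub (hD.mul_left 2), tsum_mul_left]
  constructor
  · rw [lt_div_iff₀ hDpos, ← sub_pos, ← hexcess]
    refine hsub.tsum_pos (fun n => mul_nonneg ?_ (hapos n).le) 2 (mul_pos ?_ (hapos 2))
    · have : (2:ℝ) ^ 1 ≤ 2 ^ (n : ℕ) := pow_le_pow_right₀ one_le_two NeZero.one_le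
      linarith
    · norm_num
  · rw [div_le_iff₀ hDpos]
    have hbound := hsub.tsum_le_tsum hle (hasSum_pnat_half_pow.summable.mul_left _)
    rw [tsum_mul_left, hasSum_pnat_half_pow.tsum_eq, hexcess, mul_one] at hbound
    have := mul_le_mul_of_nonneg_right hfirst (show (0:ℝ) ≤ 8 / q ^ 2 by positivity)
    linarith

theorem partial_pressure_exp_digit (t : ℝ) (ht : 0 ≤ t) :
    (∀ q : ℝ, q < 0 →
      2 < (∑' n : ℕ+, (2:ℝ) ^ (-((n : ℕ) : ℝ) * (t - 1)) * Real.exp ((2:ℝ) ^ (n : ℕ) * q)) /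
            (∑' n : ℕ+, (2:ℝ) ^ (-((n : ℕ) : ℝ) * t) * Real.exp ((2:ℝ) ^ (n : ℕ) * q))) ∧
    Tendsto
      (fun q : ℝ =>
        (∑' n : ℕ+, (2:ℝ) ^ (-((n : ℕ) : ℝ) * (t - 1)) * Real.exp ((2:ℝ) ^ (n : ℕ) * q)) /
          (∑' n : ℕ+, (2:ℝ) ^ (-((n : ℕ) : ℝ) * t) * Real.exp ((2:ℝ) ^ (n : ℕ) * q)))
      atBot (nhds 2) := by
  refine ⟨fun q hq => (digit_ratio_bounds ht hq).1, ?_⟩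
  have hlim : Tendsto (fun q : ℝ => 2 + 8 / q ^ 2) atBot (nhds 2) := by
    have hsq : Tendsto (fun q : ℝ => q ^ 2) atBot atTop := by
      simpa [Function.comp_def] using
        (tendsto_pow_atTop (α := ℝ) two_ne_zero).comp tendsto_neg_atBot_atTop
    simpa using (tendsto_const_nhds (x := (2:ℝ))).add (hsq.const_div_atTop 8)
  refine tendsto_of_tendsto_of_tendsto_of_le_of_le' tendsto_const_nhds hlim ?_ ?_
  · filter_upwards [eventually_lt_atBot 0] with q hq using (digit_ratio_bounds ht hq).1.le
  · filter_upwards [eventually_lt_atBot 0] with q hq using (digit_ratio_bounds ht hq).2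
end
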